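/- Let d ≥ 1, 1 < q < d+2, β ∈ (1, (d+2)/q], and let r satisfy r(β − 1) = qβ. Then there exists a constant N = N(d, q, β) such that for every u ∈ C_0^∞(ℝ^{d+1}) one has ‖Du‖_{E_{r, β−1}} ≤ N ‖∂_t u + Δu‖_{E_{q, β}}. -/

import Mathlib

open MeasureTheory Set ENNReal Filter

noncomputable section

/-- Euclidean space `ℝ^d`. -/
abbrev Ed (d : ℕ) := EuclideanSpace ℝ (Fin d)

/-- Points of `ℝ^{d+1}`: `z = (t, x)`. -/
abbrev Pt (d : ℕ) := ℝ × Ed d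

/-- The parabolic cylinder `C_ρ(t,x)`. -/
def pCyl (d : ℕ) (ρ : ℝ) (z : Pt d) : Set (Pt d) :=
  {w | dist z.2 w.2 < ρ ∧ z.1 ≤ w.1 ∧ w.1 < z.1 + ρ ^ 2}

/-- The average `⨍_{C_ρ(z)} f`. -/
def pAvg (d : ℕ) (ρ : ℝ) (z : Pt d) (f : Pt d → ℝ≥0∞) : ℝ≥0∞ :=
  (volume (pCyl d ρ z))⁻¹ * ∫⁻ w in pCyl d ρ z, f w

/-- The fractional maximal function `M_β f`. -/
def Mbeta (d : ℕ) (β : ℝ) (f : Pt d → ℝ≥0∞) (z : Pt d) : ℝ≥0∞ :=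
  ⨆ (ρ : ℝ) (_ : 0 < ρ), ENNReal.ofReal (ρ ^ β) * pAvg d ρ z f

/-- The kernel `p_α(s, r)`. -/
def pKer (d : ℕ) (α : ℝ) (s r : ℝ) : ℝ≥0∞ :=
  if 0 < s then ENNReal.ofReal (s ^ (-(((d : ℝ) + 2 - α) / 2)) * Real.exp (-(r ^ 2) / s)) else 0

/-- The parabolic potential `P_α f`. -/
def Palpha (d : ℕ) (α : ℝ) (f : Pt d → ℝ≥0∞) (z : Pt d) : ℝ≥0∞ :=
  ∫⁻ w : Pt d, pKer d α w.1 ‖w.2‖ * f (z.1 + w.1, z.2 + w.2)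

/-- The parabolic Morrey norm `‖f‖_{E_{p,β}(Q)}`. -/
def MorreyNorm (d : ℕ) (p β : ℝ) (Q : Set (Pt d)) (f : Pt d → ℝ≥0∞) : ℝ≥0∞ :=
  ⨆ (ρ : ℝ) (_ : 0 < ρ) (z : Pt d) (_ : z ∈ Q),
    ENNReal.ofReal (ρ ^ β) * (pAvg d ρ z fun w => Q.indicator f w ^ p) ^ (1 / p)

/-- The `L_p`-norm on `ℝ^{d+1}`. -/
def LpNormE (d : ℕ) (p : ℝ) (f : Pt d → ℝ≥0∞) : ℝ≥0∞ :=
  (∫⁻ z : Pt d, f z ^ p) ^ (1 / p)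

/-- The mixed norm `‖f‖_{L_{q₁,q₂}}`. -/
def MixedNorm (d : ℕ) (q₁ q₂ : ℝ) (f : Pt d → ℝ≥0∞) : ℝ≥0∞ :=
  (∫⁻ t : ℝ, (∫⁻ x : Ed d, f (t, x) ^ q₁) ^ (q₂ / q₁)) ^ (1 / q₂)

/-- The normalized mixed norm `‖f‖_{L_{q₁,q₂}(Γ)}`. -/
def MixedNormOn (d : ℕ) (q₁ q₂ : ℝ) (Γ : Set (Pt d)) (f : Pt d → ℝ≥0∞) : ℝ≥0∞ :=
  (MixedNorm d q₁ q₂ (Γ.indicator 1))⁻¹ * MixedNorm d q₁ q₂ (Γ.indicator f)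

/-- The mixed-norm parabolic Morrey norm `‖f‖_{E_{q₁,q₂,β}(Q)}`. -/
def MixedMorrey (d : ℕ) (q₁ q₂ β : ℝ) (Q : Set (Pt d)) (f : Pt d → ℝ≥0∞) : ℝ≥0∞ :=
  ⨆ (ρ : ℝ) (_ : 0 < ρ) (z : Pt d) (_ : z ∈ Q),
    ENNReal.ofReal (ρ ^ β) * MixedNormOn d q₁ q₂ (pCyl d ρ z) (Q.indicator f)

/-- The symmetric parabolic maximal function `M̂ f`. -/
def pMax (d : ℕ) (f : Pt d → ℝ≥0∞) (z : Pt d) : ℝ≥0∞ :=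
  ⨆ (r : ℝ) (_ : 0 < r) (w : Pt d) (_ : z ∈ pCyl d r w), pAvg d r w f

/-- The time derivative `∂_t u`. -/
def timeDeriv (d : ℕ) (u : Pt d → ℝ) (z : Pt d) : ℝ :=
  fderiv ℝ u z ((1 : ℝ), (0 : Ed d))

/-- The spatial partial derivative `D_i u`. -/
def spDeriv (d : ℕ) (i : Fin d) (u : Pt d → ℝ) (z : Pt d) : ℝ :=
  fderiv ℝ u z ((0 : ℝ), EuclideanSpace.single i (1 : ℝ))

/-- The Euclidean norm of the spatial gradient `|Du|`. -/
def gradNorm (d : ℕ) (u : Pt d → ℝ) (z : Pt d) : ℝ :=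
  Real.sqrt (∑ i : Fin d, spDeriv d i u z ^ 2)

/-- The spatial Laplacian `Δu`. -/
def lap (d : ℕ) (u : Pt d → ℝ) (z : Pt d) : ℝ :=
  ∑ i : Fin d, spDeriv d i (spDeriv d i u) z

/-- The (Frobenius) norm of the spatial Hessian `|D²u|`. -/
def hessNorm (d : ℕ) (u : Pt d → ℝ) (z : Pt d) : ℝ :=
  Real.sqrt (∑ i : Fin d, ∑ j : Fin d, spDeriv d i (spDeriv d j u) z ^ 2)



lemma doob_aux {α : Type*} [MeasurableSpace α] (μ ν : Measure α) (H F : α → ℝ)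
    (hF0 : ∀ a, 0 ≤ F a) (hHm : Measurable H) (hFm : Measurable F)
    (q : ℝ) (hq : 1 < q) (hH0 : ∀ a, 0 ≤ H a)
    (hw : ∀ τ, 0 < τ → ENNReal.ofReal τ * μ {a | τ < H a} ≤
      ∫⁻ a in {a | τ < F a}, ENNReal.ofReal (F a) ∂ν) :
    ∫⁻ a, ENNReal.ofReal (H a ^ q) ∂μ ≤
      ENNReal.ofReal (q / (q - 1)) * ∫⁻ a, ENNReal.ofReal (F a ^ q) ∂ν := by
  set ν' := ν.withDensity (fun a => ENNReal.ofReal (F a)) with hν'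
  have hq1 : 0 < q - 1 := by linarith
  have hq0 : 0 < q := by linarith
  have e1 := lintegral_rpow_eq_lintegral_meas_lt_mul ν' (Filter.Eventually.of_forall hF0)
    hFm.aemeasurable hq1
  have e2 : ∫⁻ a, ENNReal.ofReal (F a ^ (q - 1)) ∂ν' = ∫⁻ a, ENNReal.ofReal (F a ^ q) ∂ν := by
    rw [hν', lintegral_withDensity_eq_lintegral_mul _ hFm.ennreal_ofReal
      (hFm.pow_const _).ennreal_ofReal]
    refine lintegral_congr fun a => ?_
    simp only [Pi.mul_apply]
    rw [← ENNReal.ofReal_mul (hF0 a)]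
    congr 1
    rcases (hF0 a).eq_or_lt with h | h
    · rw [← h, Real.zero_rpow (by linarith : q ≠ 0)]; simp
    · rw [Real.rpow_sub_one h.ne']; field_simp
  rw [lintegral_rpow_eq_lintegral_meas_lt_mul μ (Filter.Eventually.of_forall hH0)
    hHm.aemeasurable hq0]
  have e3 : ∫⁻ t in Set.Ioi (0:ℝ), μ {a | t < H a} * ENNReal.ofReal (t ^ (q - 1)) ≤
      ∫⁻ t in Set.Ioi (0:ℝ), ν' {a | t < F a} * ENNReal.ofReal (t ^ (q - 1 - 1)) := by
    refine setLIntegral_mono' measurableSet_Ioi fun t ht => ?_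
    have ht : 0 < t := ht
    have h1 := hw t ht
    have h2 : ν' {a | t < F a} = ∫⁻ a in {a | t < F a}, ENNReal.ofReal (F a) ∂ν := by
      rw [hν', withDensity_apply _ (measurableSet_lt measurable_const hFm)]
    rw [h2]
    have h3 : ENNReal.ofReal (t ^ (q - 1)) =
        ENNReal.ofReal t * ENNReal.ofReal (t ^ (q - 1 - 1)) := by
      rw [← ENNReal.ofReal_mul ht.le, Real.rpow_sub_one ht.ne' (q - 1)]
      congr 1
      field_simp
    rw [h3, ← mul_assoc, mul_comm (μ _)]
    gcongr
  rw [← e2, e1, ← mul_assoc, ← ENNReal.ofReal_mul (by positivity)]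
  rw [div_mul_cancel₀ _ hq1.ne']
  gcongr

lemma doob_loc {α : Type*} [MeasurableSpace α] (μ ν : Measure α) (H F : α → ℝ)
    (hF0 : ∀ a, 0 ≤ F a) (hHm : Measurable H) (hFm : Measurable F)
    (q : ℝ) (hq : 1 < q) (hH0 : ∀ a, 0 ≤ H a) (τ0 : ℝ) (hτ0 : 0 < τ0)
    (hw : ∀ τ, τ0 ≤ τ → ENNReal.ofReal τ * μ {a | τ < H a} ≤
      ∫⁻ a in {a | τ < F a}, ENNReal.ofReal (F a) ∂ν) :
    ∫⁻ a, ENNReal.ofReal (H a ^ q) ∂μ ≤ ENNReal.ofReal (2 ^ q * τ0 ^ q) * μ univ +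
      ENNReal.ofReal (2 ^ q * (q / (q - 1))) * ∫⁻ a, ENNReal.ofReal (F a ^ q) ∂ν := by
  have hq1 : 0 < q - 1 := by linarith
  have key := doob_aux μ ν (fun a => max (H a - τ0) 0) F hF0
    ((hHm.sub_const _).max measurable_const) hFm q hq (fun a => le_max_right _ _) (by
      intro τ hτ
      have h1 : {a | τ < max (H a - τ0) 0} = {a | τ + τ0 < H a} := by
        ext a
        simp only [mem_ofPred_eq, lt_max_iff]
        constructor
        · rintro (h | h) <;> linarith
        · intro h; left; linarith
      rw [h1]
      calc _ ≤ ENNReal.ofReal (τ + τ0) * μ {a | τ + τ0 < H a} := by gcongr; linarith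
        _ ≤ _ := hw _ (by linarith)
        _ ≤ _ := by
          refine lintegral_mono_set fun a ha => ?_
          simp only [mem_ofPred_eq] at ha ⊢
          linarith)
  have h2 : ∀ a, ENNReal.ofReal (H a ^ q) ≤ ENNReal.ofReal (2 ^ q * τ0 ^ q) +
      ENNReal.ofReal (2 ^ q) * ENNReal.ofReal ((max (H a - τ0) 0) ^ q) := by
    intro a
    have hm : 0 ≤ max (H a - τ0) 0 := le_max_right _ _
    rw [← ENNReal.ofReal_mul (by positivity), ← ENNReal.ofReal_add (by positivity) (by positivity)]
    apply ENNReal.ofReal_le_ofReal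
    rw [← mul_add]
    rcases le_total (H a) (2 * τ0) with h | h
    · calc H a ^ q ≤ (2 * τ0) ^ q := Real.rpow_le_rpow (hH0 a) h (by linarith)
        _ = 2 ^ q * τ0 ^ q := Real.mul_rpow (by norm_num) hτ0.le
        _ ≤ _ := by
          gcongr
          exact le_add_of_nonneg_right (by positivity)
    · calc H a ^ q ≤ (2 * max (H a - τ0) 0) ^ q := by
            apply Real.rpow_le_rpow (hH0 a) _ (by linarith)
            have := le_max_left (H a - τ0) 0
            linarith
        _ = 2 ^ q * (max (H a - τ0) 0) ^ q := Real.mul_rpow (by norm_num) hm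
        _ ≤ _ := by
          gcongr
          exact le_add_of_nonneg_left (by positivity)
  calc _ ≤ ∫⁻ a, (ENNReal.ofReal (2 ^ q * τ0 ^ q) +
      ENNReal.ofReal (2 ^ q) * ENNReal.ofReal ((max (H a - τ0) 0) ^ q)) ∂μ := lintegral_mono h2
    _ = ENNReal.ofReal (2 ^ q * τ0 ^ q) * μ univ +
      ENNReal.ofReal (2 ^ q) * ∫⁻ a, ENNReal.ofReal ((max (H a - τ0) 0) ^ q) ∂μ := by
        rw [lintegral_add_left measurable_const, lintegral_const, lintegral_const_mul]
        exact (((hHm.sub_const _).max measurable_const).pow_const _).ennreal_ofReal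
    _ ≤ _ := by
        rw [ENNReal.ofReal_mul (by positivity : (0:ℝ) ≤ 2 ^ q) (q := q / (q - 1)), mul_assoc]
        gcongr

lemma pCyl_eq (d : ℕ) (ρ : ℝ) (z : Pt d) :
    pCyl d ρ z = Ico z.1 (z.1 + ρ ^ 2) ×ˢ Metric.ball z.2 ρ := by
  ext w
  simp only [pCyl, mem_ofPred_eq, mem_prod, mem_Ico, Metric.mem_ball, dist_comm w.2]
  tauto

def Vd (d : ℕ) : ℝ := (volume (Metric.ball (0 : Ed d) 1)).toReal

lemma Vd_pos (d : ℕ) : 0 < Vd d :=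
  ENNReal.toReal_pos (Metric.measure_ball_pos _ _ one_pos).ne' measure_ball_lt_top.ne

lemma vol_ball (d : ℕ) (hd : 1 ≤ d) (x : Ed d) (ρ : ℝ) (hρ : 0 < ρ) :
    volume (Metric.ball x ρ) = ENNReal.ofReal (ρ ^ d * Vd d) := by
  have : Nonempty (Fin d) := ⟨⟨0, hd⟩⟩
  rw [Measure.addHaar_ball _ _ hρ.le, Vd, ENNReal.ofReal_mul (by positivity),
    ENNReal.ofReal_toReal measure_ball_lt_top.ne]
  simp

lemma meas_pCyl (d : ℕ) (ρ : ℝ) (z : Pt d) : MeasurableSet (pCyl d ρ z) := by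
  rw [pCyl_eq]
  exact measurableSet_Ico.prod measurableSet_ball

lemma vol_pCyl (d : ℕ) (hd : 1 ≤ d) (ρ : ℝ) (hρ : 0 < ρ) (z : Pt d) :
    volume (pCyl d ρ z) = ENNReal.ofReal (Vd d * ρ ^ (d + 2)) := by
  rw [pCyl_eq, Measure.volume_eq_prod, Measure.prod_prod, vol_ball d hd _ _ hρ, Real.volume_Ico,
    ← ENNReal.ofReal_mul (by ring_nf; positivity)]
  congr 1
  ring

lemma refl_eq (d : ℕ) (ρ : ℝ) (w : Pt d) :
    {z : Pt d | w ∈ pCyl d ρ z} = Ioc (w.1 - ρ ^ 2) w.1 ×ˢ Metric.ball w.2 ρ := by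
  ext z
  simp only [pCyl, mem_ofPred_eq, mem_prod, mem_Ioc, Metric.mem_ball, sub_lt_iff_lt_add]
  tauto

lemma meas_refl (d : ℕ) (ρ : ℝ) (w : Pt d) : MeasurableSet {z : Pt d | w ∈ pCyl d ρ z} := by
  rw [refl_eq]
  exact measurableSet_Ioc.prod measurableSet_ball

lemma vol_pCyl_refl (d : ℕ) (hd : 1 ≤ d) (ρ : ℝ) (hρ : 0 < ρ) (w : Pt d) :
    volume {z : Pt d | w ∈ pCyl d ρ z} = ENNReal.ofReal (Vd d * ρ ^ (d + 2)) := by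
  rw [refl_eq, Measure.volume_eq_prod, Measure.prod_prod, vol_ball d hd _ _ hρ, Real.volume_Ioc,
    ← ENNReal.ofReal_mul (by ring_nf; positivity)]
  congr 1
  ring

lemma pCyl_sub (d : ℕ) (ρ R : ℝ) (hR : 0 < R) (hRρ : R ≤ ρ) (z0 z w : Pt d)
    (hz : z ∈ pCyl d ρ z0) (hw : w ∈ pCyl d R z) : w ∈ pCyl d (2 * ρ) z0 := by
  obtain ⟨a1, a2, a3⟩ := hz
  obtain ⟨b1, b2, b3⟩ := hw
  refine ⟨?_, by linarith, ?_⟩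
  · have := dist_triangle z0.2 z.2 w.2
    linarith
  · nlinarith

lemma meas_cyl_rel (d : ℕ) (R : ℝ) : MeasurableSet {p : Pt d × Pt d | p.2 ∈ pCyl d R p.1} := by
  have h1 : MeasurableSet {p : Pt d × Pt d | dist p.1.2 p.2.2 < R} :=
    measurableSet_lt (by fun_prop) measurable_const
  have h2 : MeasurableSet {p : Pt d × Pt d | p.1.1 ≤ p.2.1} :=
    measurableSet_le (by fun_prop) (by fun_prop)
  have h3 : MeasurableSet {p : Pt d × Pt d | p.2.1 < p.1.1 + R ^ 2} :=
    measurableSet_lt (by fun_prop) (by fun_prop)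
  exact h1.inter (h2.inter h3)

/-- Fubini: integral of cylinder integrals. -/
lemma fubini_cyl (d : ℕ) (hd : 1 ≤ d) (ρ R : ℝ) (hR : 0 < R) (hRρ : R ≤ ρ) (z0 : Pt d)
    (h : Pt d → ℝ≥0∞) (hm : Measurable h) :
    ∫⁻ z in pCyl d ρ z0, ∫⁻ w in pCyl d R z, h w ≤
      ENNReal.ofReal (Vd d * R ^ (d + 2)) * ∫⁻ w in pCyl d (2 * ρ) z0, h w := by
  have hS := meas_cyl_rel d R
  set C := pCyl d (2 * ρ) z0 with hC
  let k : Pt d → Pt d → ℝ≥0∞ := fun z w =>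
    {p : Pt d × Pt d | p.2 ∈ pCyl d R p.1}.indicator (fun p => h p.2) (z, w)
  have h1 : ∀ z ∈ pCyl d ρ z0, ∫⁻ w in pCyl d R z, h w = ∫⁻ w in C, k z w := by
    intro z hz
    rw [← lintegral_indicator (meas_pCyl d R z), ← lintegral_indicator (meas_pCyl _ _ _)]
    refine lintegral_congr fun w => ?_
    by_cases hw : w ∈ pCyl d R z
    · have := pCyl_sub d ρ R hR hRρ z0 z w hz hw
      simp [indicator, hw, k, this]
    · simp [indicator, hw, k]
  have hk : Measurable (Function.uncurry k) := (hm.comp measurable_snd).indicator hS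
  rw [setLIntegral_congr_fun (meas_pCyl _ _ _) h1, lintegral_lintegral_swap hk.aemeasurable,
    ← lintegral_const_mul _ hm]
  refine lintegral_mono fun w => ?_
  calc ∫⁻ z in pCyl d ρ z0, k z w ≤ ∫⁻ z, k z w := setLIntegral_le_lintegral _ _
    _ = ∫⁻ z, {z : Pt d | w ∈ pCyl d R z}.indicator (fun _ => h w) z := by
        refine lintegral_congr fun z => ?_
        simp [indicator, k]
    _ = h w * volume {z : Pt d | w ∈ pCyl d R z} := lintegral_indicator_const (meas_refl d R w) _
    _ = _ := by rw [vol_pCyl_refl d hd R hR, mul_comm]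

/-- weighted cylinder integral -/
def TT (d : ℕ) (R : ℝ) (h : Pt d → ℝ≥0∞) (z : Pt d) : ℝ≥0∞ :=
  ENNReal.ofReal ((R ^ (d + 1))⁻¹) * ∫⁻ w in pCyl d R z, h w

lemma meas_TT (d : ℕ) (R : ℝ) (h : Pt d → ℝ≥0∞) (hm : Measurable h) : Measurable (TT d R h) := by
  unfold TT
  refine Measurable.const_mul ?_ _
  let k : Pt d → Pt d → ℝ≥0∞ := fun z w =>
    {p : Pt d × Pt d | p.2 ∈ pCyl d R p.1}.indicator (fun p => h p.2) (z, w)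
  have hk : Measurable (Function.uncurry k) :=
    (hm.comp measurable_snd).indicator (meas_cyl_rel d R)
  have : (fun z => ∫⁻ w in pCyl d R z, h w) = fun z => ∫⁻ w, k z w := by
    funext z
    rw [← lintegral_indicator (meas_pCyl d R z)]
    refine lintegral_congr fun w => ?_
    simp [indicator, k]
  rw [this]
  exact hk.lintegral_prod_right

lemma TT_add_le (d : ℕ) (R : ℝ) (f g h : Pt d → ℝ≥0∞) (hg : Measurable g)
    (hf : ∀ w, f w ≤ g w + h w) (z : Pt d) : TT d R f z ≤ TT d R g z + TT d R h z := by
  unfold TT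
  rw [← mul_add, ← lintegral_add_left hg]
  gcongr with w
  exact hf w

lemma TT_const (d : ℕ) (hd : 1 ≤ d) (R : ℝ) (hR : 0 < R) (τ : ℝ) (hτ : 0 ≤ τ) (z : Pt d) :
    TT d R (fun _ => ENNReal.ofReal τ) z = ENNReal.ofReal (τ * Vd d * R) := by
  have := Vd_pos d
  unfold TT
  rw [setLIntegral_const, vol_pCyl d hd R hR, ← ENNReal.ofReal_mul hτ,
    ← ENNReal.ofReal_mul (by positivity)]
  congr 1
  field_simp
  ring

lemma int_TT (d : ℕ) (hd : 1 ≤ d) (ρ R : ℝ) (hR : 0 < R) (hRρ : R ≤ ρ) (z0 : Pt d)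
    (h : Pt d → ℝ≥0∞) (hm : Measurable h) :
    ∫⁻ z in pCyl d ρ z0, TT d R h z ≤
      ENNReal.ofReal (Vd d * R) * ∫⁻ w in pCyl d (2 * ρ) z0, h w := by
  have := Vd_pos d
  unfold TT
  rw [lintegral_const_mul' _ _ ENNReal.ofReal_ne_top]
  calc _ ≤ ENNReal.ofReal ((R ^ (d + 1))⁻¹) *
      (ENNReal.ofReal (Vd d * R ^ (d + 2)) * ∫⁻ w in pCyl d (2 * ρ) z0, h w) := by
        gcongr
        exact fubini_cyl d hd ρ R hR hRρ z0 h hm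
    _ = _ := by
        rw [← mul_assoc, ← ENNReal.ofReal_mul (by positivity)]
        congr 2
        field_simp
        ring

lemma tsum_half (a : ℝ) (ha : 0 ≤ a) :
    ∑' k : ℕ, ENNReal.ofReal (a / 2 ^ (k + 1)) = ENNReal.ofReal a := by
  have h : HasSum (fun k : ℕ => a / 2 / 2 ^ k) a := hasSum_geometric_two' a
  have e : (fun k : ℕ => a / 2 ^ (k + 1)) = fun k : ℕ => a / 2 / 2 ^ k := by
    funext k; rw [pow_succ]; field_simp
  rw [← ENNReal.ofReal_tsum_of_nonneg (fun k => by positivity) (by rw [e]; exact h.summable), e,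
    h.tsum_eq]

def thet (β : ℝ) : ℝ := (1 - 2 ^ (1 - β))⁻¹

lemma thet_pos (β : ℝ) (hβ : 1 < β) : 0 < thet β := by
  unfold thet
  rw [inv_pos, sub_pos]
  exact Real.rpow_lt_one_of_one_lt_of_neg (by norm_num) (by linarith)

lemma tsum_far (β : ℝ) (hβ : 1 < β) (a δ : ℝ) (ha : 0 ≤ a) (hδ : 0 < δ) :
    ∑' k : ℕ, ENNReal.ofReal (a * (δ * 2 ^ k) ^ (1 - β)) =
      ENNReal.ofReal (a * thet β * δ ^ (1 - β)) := by
  have hx1 : (2:ℝ) ^ (1 - β) < 1 := Real.rpow_lt_one_of_one_lt_of_neg (by norm_num) (by linarith)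
  have hx0 : (0:ℝ) ≤ 2 ^ (1 - β) := by positivity
  have e : (fun k : ℕ => a * (δ * 2 ^ k) ^ (1 - β)) =
      fun k : ℕ => (a * δ ^ (1 - β)) * ((2:ℝ) ^ (1 - β)) ^ k := by
    funext k
    rw [Real.mul_rpow hδ.le (by positivity), ← Real.rpow_natCast, ← Real.rpow_natCast,
      ← Real.rpow_mul (by norm_num), ← Real.rpow_mul (by norm_num), mul_comm (k : ℝ)]
    ring
  have hs := (hasSum_geometric_of_lt_one hx0 hx1).mul_left (a * δ ^ (1 - β))
  rw [← ENNReal.ofReal_tsum_of_nonneg (fun k => by positivity) (by rw [e]; exact hs.summable), e,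
    hs.tsum_eq]
  congr 1
  unfold thet
  ring

lemma weak_type (d : ℕ) (hd : 1 ≤ d) (β : ℝ) (hβ : 1 < β) (N0 : ℝ) (hN0 : 0 < N0)
    (F G : Pt d → ℝ) (hFm : Measurable F) (hGm : Measurable G)
    (hM : ∀ R, 0 < R → ∀ z, ∫⁻ w in pCyl d R z, ENNReal.ofReal (F w) ≤
      ENNReal.ofReal (Vd d * R ^ (d + 2) * R ^ (-β)))
    (hG : ∀ δ, 0 < δ → ∀ z, ENNReal.ofReal (G z) ≤ ENNReal.ofReal N0 *
      (∑' k : ℕ, TT d (δ / 2 ^ (k + 1)) (fun w => ENNReal.ofReal (F w)) z +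
        ∑' k : ℕ, TT d (δ * 2 ^ k) (fun w => ENNReal.ofReal (F w)) z))
    (ρ δ : ℝ) (hδ : 0 < δ) (hδρ : δ ≤ ρ) (z0 : Pt d) :
    ENNReal.ofReal (thet β / 2 * δ ^ (-β)) *
      volume.restrict (pCyl d ρ z0) {z | 2 * N0 * Vd d * thet β * δ ^ (1 - β) < G z} ≤
    ∫⁻ w in {w | thet β / 2 * δ ^ (-β) < F w}, ENNReal.ofReal (F w)
      ∂(volume.restrict (pCyl d (2 * ρ) z0)) := by
  have hV := Vd_pos d
  have hθ := thet_pos β hβ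
  set τ := thet β / 2 * δ ^ (-β) with hτ
  set lam := 2 * N0 * Vd d * thet β * δ ^ (1 - β) with hlam
  have hτ0 : 0 < τ := by positivity
  have hlam0 : 0 < lam := by positivity
  have hrel : N0 * (τ * Vd d * δ) = lam / 4 := by
    have : δ ^ (1 - β) = δ * δ ^ (-β) := by
      rw [sub_eq_add_neg, Real.rpow_add hδ, Real.rpow_one]
    rw [hlam, hτ, this]; ring
  have hS : MeasurableSet {w | τ < F w} := measurableSet_lt measurable_const hFm
  set h : Pt d → ℝ≥0∞ := {w | τ < F w}.indicator (fun w => ENNReal.ofReal (F w)) with hh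
  have hm : Measurable h := hFm.ennreal_ofReal.indicator hS
  have hFle : ∀ w, ENNReal.ofReal (F w) ≤ ENNReal.ofReal τ + h w := by
    intro w
    by_cases hw : τ < F w
    · simp [h, hw]
    · push Not at hw
      exact (ENNReal.ofReal_le_ofReal hw).trans le_self_add
  have hfar : ∀ z, ∑' k : ℕ, TT d (δ * 2 ^ k) (fun w => ENNReal.ofReal (F w)) z ≤
      ENNReal.ofReal (Vd d * thet β * δ ^ (1 - β)) := by
    intro z
    rw [← tsum_far β hβ (Vd d) δ hV.le hδ]
    refine ENNReal.tsum_le_tsum fun k => ?_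
    have hR : 0 < δ * 2 ^ k := by positivity
    set R := δ * 2 ^ k
    unfold TT
    calc _ ≤ ENNReal.ofReal ((R ^ (d + 1))⁻¹) *
        ENNReal.ofReal (Vd d * R ^ (d + 2) * R ^ (-β)) := by
          gcongr
          exact hM R hR z
      _ = _ := by
          rw [← ENNReal.ofReal_mul (by positivity)]
          congr 1
          rw [sub_eq_add_neg, Real.rpow_add hR, Real.rpow_one]
          field_simp
          ring
  have hnear : ∀ z, ∑' k : ℕ, TT d (δ / 2 ^ (k + 1)) (fun w => ENNReal.ofReal (F w)) z ≤
      ENNReal.ofReal (τ * Vd d * δ) + ∑' k : ℕ, TT d (δ / 2 ^ (k + 1)) h z := by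
    intro z
    rw [← tsum_half (τ * Vd d * δ) (by positivity), ← ENNReal.tsum_add]
    refine ENNReal.tsum_le_tsum fun k => ?_
    refine (TT_add_le d _ _ (fun _ => ENNReal.ofReal τ) h measurable_const hFle z).trans ?_
    rw [TT_const d hd _ (by positivity) τ hτ0.le, mul_div_assoc]
  have hpt : ∀ z, lam < G z → ENNReal.ofReal (lam / 4) ≤
      ENNReal.ofReal N0 * ∑' k : ℕ, TT d (δ / 2 ^ (k + 1)) h z := by
    intro z hz
    set X := ENNReal.ofReal N0 * ∑' k : ℕ, TT d (δ / 2 ^ (k + 1)) h z with hX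
    have h1 : ENNReal.ofReal lam ≤ X + ENNReal.ofReal (3 * lam / 4) := by
      calc ENNReal.ofReal lam ≤ ENNReal.ofReal (G z) := ENNReal.ofReal_le_ofReal hz.le
        _ ≤ _ := hG δ hδ z
        _ ≤ ENNReal.ofReal N0 * ((ENNReal.ofReal (τ * Vd d * δ) +
            ∑' k : ℕ, TT d (δ / 2 ^ (k + 1)) h z) +
              ENNReal.ofReal (Vd d * thet β * δ ^ (1 - β))) := by
            gcongr
            · exact hnear z
            · exact hfar z
        _ = _ := by
            rw [mul_add, mul_add, ← hX, ← ENNReal.ofReal_mul hN0.le, ← ENNReal.ofReal_mul hN0.le,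
              add_comm _ X, add_assoc, ← ENNReal.ofReal_add (by positivity) (by positivity), hrel]
            congr 2
            rw [hlam]; ring
    have h2 : ENNReal.ofReal lam = ENNReal.ofReal (lam / 4) + ENNReal.ofReal (3 * lam / 4) := by
      rw [← ENNReal.ofReal_add (by positivity) (by positivity)]; congr 1; ring
    rw [h2] at h1
    exact (ENNReal.add_le_add_iff_right ENNReal.ofReal_ne_top).1 h1
  have hSG : MeasurableSet {z | lam < G z} := measurableSet_lt measurable_const hGm
  have hmain : ENNReal.ofReal (lam / 4) * volume.restrict (pCyl d ρ z0) {z | lam < G z} ≤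
      ENNReal.ofReal (N0 * (Vd d * δ)) * ∫⁻ w in pCyl d (2 * ρ) z0, h w := by
    calc _ = ∫⁻ z in {z | lam < G z}, ENNReal.ofReal (lam / 4)
          ∂(volume.restrict (pCyl d ρ z0)) := by rw [setLIntegral_const]
      _ ≤ ∫⁻ z in {z | lam < G z}, ENNReal.ofReal N0 * ∑' k : ℕ, TT d (δ / 2 ^ (k + 1)) h z
          ∂(volume.restrict (pCyl d ρ z0)) := setLIntegral_mono' hSG hpt
      _ ≤ ∫⁻ z in pCyl d ρ z0, ENNReal.ofReal N0 * ∑' k : ℕ, TT d (δ / 2 ^ (k + 1)) h z :=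
          setLIntegral_le_lintegral _ _
      _ = ENNReal.ofReal N0 * ∑' k : ℕ, ∫⁻ z in pCyl d ρ z0, TT d (δ / 2 ^ (k + 1)) h z := by
          rw [lintegral_const_mul' _ _ ENNReal.ofReal_ne_top, lintegral_tsum]
          exact fun k => (meas_TT d _ h hm).aemeasurable
      _ ≤ ENNReal.ofReal N0 * ∑' k : ℕ, ENNReal.ofReal ((Vd d * δ) / 2 ^ (k + 1)) *
            ∫⁻ w in pCyl d (2 * ρ) z0, h w := by
          gcongr with k
          rw [mul_div_assoc]
          refine int_TT d hd ρ _ (by positivity) (le_trans ?_ hδρ) z0 h hm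
          exact div_le_self hδ.le (one_le_pow₀ (by norm_num))
      _ = _ := by
          rw [ENNReal.tsum_mul_right, tsum_half _ (by positivity), ← mul_assoc,
            ENNReal.ofReal_mul hN0.le]
  have h5 : lam / 4 = (N0 * (Vd d * δ)) * τ := by rw [← hrel]; ring
  rw [h5, ENNReal.ofReal_mul (by positivity), mul_assoc,
    ENNReal.mul_le_mul_iff_right (by simp; positivity) ENNReal.ofReal_ne_top] at hmain
  rw [← lintegral_indicator hS]
  exact hmain

lemma adams (d : ℕ) (hd : 1 ≤ d) (q β r : ℝ) (hq : 1 < q) (hβ : 1 < β)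
    (hr : r * (β - 1) = q * β) (N0 : ℝ) (hN0 : 0 < N0) :
    ∃ A : ℝ, 0 < A ∧ ∀ F G : Pt d → ℝ, Measurable F → Measurable G → (∀ z, 0 ≤ F z) →
    (∀ z, 0 ≤ G z) →
    (∀ R, 0 < R → ∀ z, ∫⁻ w in pCyl d R z, ENNReal.ofReal (F w) ≤
      ENNReal.ofReal (Vd d * R ^ (d + 2) * R ^ (-β))) →
    (∀ R, 0 < R → ∀ z, ∫⁻ w in pCyl d R z, ENNReal.ofReal (F w ^ q) ≤
      ENNReal.ofReal (Vd d * R ^ (d + 2) * R ^ (-(β * q)))) →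
    (∀ δ, 0 < δ → ∀ z, ENNReal.ofReal (G z) ≤ ENNReal.ofReal N0 *
      (∑' k : ℕ, TT d (δ / 2 ^ (k + 1)) (fun w => ENNReal.ofReal (F w)) z +
        ∑' k : ℕ, TT d (δ * 2 ^ k) (fun w => ENNReal.ofReal (F w)) z)) →
    ∀ ρ, 0 < ρ → ∀ z0, ∫⁻ w in pCyl d ρ z0, ENNReal.ofReal (G w ^ r) ≤
      ENNReal.ofReal (A * (Vd d * ρ ^ (d + 2) * ρ ^ (-(β * q)))) := by
  have hV := Vd_pos d
  have hθ := thet_pos β hβ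
  have hβ1 : 0 < β - 1 := by linarith
  have hq1 : 0 < q - 1 := by linarith
  set e := β / (β - 1) with he
  have he0 : 0 < e := by positivity
  have heq : e * q = r := by rw [he]; field_simp; linarith
  set L := 2 * N0 * Vd d * thet β with hL
  have hL0 : 0 < L := by positivity
  set b := thet β / 2 * L ^ (-e) with hb
  have hb0 : 0 < b := by positivity
  set A1 := 2 ^ q * (thet β / 2) ^ q + 2 ^ q * (q / (q - 1)) * (2 ^ (d + 2) * 2 ^ (-(β * q)))
    with hA1
  have hA10 : 0 < A1 := by positivity
  refine ⟨A1 / b ^ q, by positivity, ?_⟩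
  intro F G hFm hGm hF0 hG0 hM hMq hG ρ hρ z0
  set τ0 := thet β / 2 * ρ ^ (-β) with hτ0
  have hτ00 : 0 < τ0 := by positivity
  have hDoob := doob_loc (volume.restrict (pCyl d ρ z0)) (volume.restrict (pCyl d (2 * ρ) z0))
    (fun z => b * G z ^ e) F hF0 ((hGm.pow_const _).const_mul _) hFm q hq
    (fun z => by have := hG0 z; positivity) τ0 hτ00 (by
      intro τ hτ
      have hτp : 0 < τ := hτ00.trans_le hτ
      set δ := (τ / (thet β / 2)) ^ (-β⁻¹) with hδ
      have hδ0 : 0 < δ := by positivity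
      have hβ0 : 0 < β := by linarith
      have hτδ : thet β / 2 * δ ^ (-β) = τ := by
        rw [hδ, ← Real.rpow_mul (by positivity)]
        have : -β⁻¹ * -β = 1 := by field_simp
        rw [this, Real.rpow_one]
        field_simp
      have hδρ : δ ≤ ρ := by
        by_contra hcon
        push Not at hcon
        have : δ ^ (-β) < ρ ^ (-β) := Real.rpow_lt_rpow_of_neg hρ hcon (by linarith)
        have : τ < τ0 := by
          rw [← hτδ, hτ0]; gcongr
        linarith
      have hw := weak_type d hd β hβ N0 hN0 F G hFm hGm hM hG ρ δ hδ0 hδρ z0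
      rw [hτδ] at hw
      refine le_trans ?_ hw
      gcongr 1
      refine measure_mono fun z hz => ?_
      simp only [mem_ofPred_eq] at hz ⊢
      by_contra hcon
      push Not at hcon
      have h1 : G z ^ e ≤ (L * δ ^ (1 - β)) ^ e := Real.rpow_le_rpow (hG0 z) hcon he0.le
      have h2 : b * (L * δ ^ (1 - β)) ^ e = τ := by
        rw [Real.mul_rpow hL0.le (by positivity), ← Real.rpow_mul hδ0.le, hb, Real.rpow_neg hL0.le]
        have : (1 - β) * e = -β := by rw [he]; field_simp; ring
        rw [this, ← hτδ]
        field_simp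
      have h3 : b * G z ^ e ≤ τ := by rw [← h2]; gcongr
      linarith)
  have hlhs : ∀ z, ENNReal.ofReal ((b * G z ^ e) ^ q) =
      ENNReal.ofReal (b ^ q) * ENNReal.ofReal (G z ^ r) := by
    intro z
    rw [Real.mul_rpow hb0.le (Real.rpow_nonneg (hG0 z) _), ← Real.rpow_mul (hG0 z), heq,
      ENNReal.ofReal_mul (by positivity)]
  simp only [hlhs] at hDoob
  rw [lintegral_const_mul' _ _ ENNReal.ofReal_ne_top] at hDoob
  have hrhs : ENNReal.ofReal (2 ^ q * τ0 ^ q) * volume.restrict (pCyl d ρ z0) univ +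
      ENNReal.ofReal (2 ^ q * (q / (q - 1))) *
        ∫⁻ a in pCyl d (2 * ρ) z0, ENNReal.ofReal (F a ^ q) ≤
      ENNReal.ofReal (A1 * (Vd d * ρ ^ (d + 2) * ρ ^ (-(β * q)))) := by
    rw [Measure.restrict_apply_univ, vol_pCyl d hd ρ hρ]
    calc _ ≤ ENNReal.ofReal (2 ^ q * τ0 ^ q) * ENNReal.ofReal (Vd d * ρ ^ (d + 2)) +
          ENNReal.ofReal (2 ^ q * (q / (q - 1))) *
            ENNReal.ofReal (Vd d * (2 * ρ) ^ (d + 2) * (2 * ρ) ^ (-(β * q))) := by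
          gcongr
          exact hMq (2 * ρ) (by positivity) z0
      _ = _ := by
          rw [← ENNReal.ofReal_mul (by positivity), ← ENNReal.ofReal_mul (by positivity),
            ← ENNReal.ofReal_add (by positivity) (by positivity)]
          congr 1
          rw [hA1, hτ0, Real.mul_rpow (by positivity) (by positivity),
            Real.mul_rpow (by positivity) hρ.le, ← Real.rpow_mul hρ.le, mul_pow, neg_mul]
          ring
  have hfin := hDoob.trans hrhs
  have : A1 * (Vd d * ρ ^ (d + 2) * ρ ^ (-(β * q))) =
      b ^ q * (A1 / b ^ q * (Vd d * ρ ^ (d + 2) * ρ ^ (-(β * q)))) := by field_simp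
  rw [this, ENNReal.ofReal_mul (by positivity),
    ENNReal.mul_le_mul_iff_right (by simp; positivity) ENNReal.ofReal_ne_top] at hfin
  exact hfin

lemma two_le_smooth : (2 : WithTop ℕ∞) ≤ ((⊤ : ℕ∞) : WithTop ℕ∞) := by
  have : ((2 : ℕ∞) : WithTop ℕ∞) ≤ ((⊤ : ℕ∞) : WithTop ℕ∞) := WithTop.coe_le_coe.2 le_top
  exact this

/-- the (unnormalized) Gaussian -/
def gs (d : ℕ) (y : Ed d) : ℝ := Real.exp (-(1 / 4) * ‖y‖ ^ 2)

lemma gs_pos (d : ℕ) (y : Ed d) : 0 < gs d y := Real.exp_pos _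

lemma gs_cont (d : ℕ) : Continuous (gs d) := by unfold gs; fun_prop

lemma gauss_int (d : ℕ) (b : ℝ) (hb : 0 < b) :
    Integrable (fun y : Ed d => Real.exp (-b * ‖y‖ ^ 2)) ∧
      0 < ∫ y : Ed d, Real.exp (-b * ‖y‖ ^ 2) := by
  have h := GaussianFourier.integral_rexp_neg_mul_sq_norm (V := Ed d) hb
  have hpos : 0 < ∫ y : Ed d, Real.exp (-b * ‖y‖ ^ 2) := by
    rw [h]
    have := Real.pi_pos
    positivity
  refine ⟨?_, hpos⟩
  by_contra hn
  rw [integral_undef hn] at hpos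
  exact lt_irrefl _ hpos

lemma gs_integrable (d : ℕ) : Integrable (gs d) := (gauss_int d (1 / 4) (by norm_num)).1

lemma gs_integral_pos (d : ℕ) : 0 < ∫ y, gs d y := (gauss_int d (1 / 4) (by norm_num)).2

lemma norm_gs_integrable (d : ℕ) : Integrable (fun y : Ed d => ‖y‖ * gs d y) := by
  refine Integrable.mono' ((gauss_int d (1 / 8) (by norm_num)).1.const_mul 2)
    (by have := gs_cont d; exact (by fun_prop : Continuous _).aestronglyMeasurable) ?_
  refine Filter.Eventually.of_forall fun y => ?_
  have h0 := norm_nonneg y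
  rw [Real.norm_of_nonneg (mul_nonneg h0 (gs_pos d y).le), gs]
  have h1 : ‖y‖ ≤ 2 * Real.exp (1 / 8 * ‖y‖ ^ 2) := by
    have := Real.add_one_le_exp (1 / 8 * ‖y‖ ^ 2)
    nlinarith [sq_nonneg (‖y‖ - 2)]
  have h2 : Real.exp (-(1 / 8) * ‖y‖ ^ 2) =
      Real.exp (1 / 8 * ‖y‖ ^ 2) * Real.exp (-(1 / 4) * ‖y‖ ^ 2) := by
    rw [← Real.exp_add]; congr 1; ring
  rw [h2, ← mul_assoc]
  gcongr

lemma gs_decay (d : ℕ) : ∃ A : ℝ, 0 < A ∧ ∀ y : Ed d,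
    (max 1 ‖y‖) ^ (d + 1) * (‖y‖ * gs d y) ≤ A := by
  refine ⟨(d + 2).factorial * Real.exp 2, by positivity, fun y => ?_⟩
  have h0 := norm_nonneg y
  set x := ‖y‖
  have h1 : (1 + x) ^ (d + 2) ≤ (d + 2).factorial * Real.exp (1 + x) := by
    have := Real.pow_div_factorial_le_exp (1 + x) (by positivity) (d + 2)
    rwa [div_le_iff₀ (by positivity), mul_comm] at this
  have h2 : (max 1 x) ^ (d + 1) * x ≤ (1 + x) ^ (d + 2) := by
    rw [pow_succ (1 + x) (d + 1)]
    gcongr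
    · exact max_le (by linarith) (by linarith)
    · linarith
  rw [← mul_assoc]
  calc _ ≤ ((d + 2).factorial * Real.exp (1 + x)) * gs d y := by
        have := gs_pos d y
        exact mul_le_mul_of_nonneg_right (h2.trans h1) this.le
    _ = (d + 2).factorial * Real.exp (1 + x + -(1 / 4) * x ^ 2) := by
        rw [gs, Real.exp_add (1 + x), mul_assoc]
    _ ≤ _ := by
        gcongr
        nlinarith [sq_nonneg (x - 2)]

lemma gs_fderiv (d : ℕ) (j : Fin d) (y : Ed d) : DifferentiableAt ℝ (gs d) y ∧
    fderiv ℝ (gs d) y (EuclideanSpace.single j 1) = -(1 / 2) * (y j * gs d y) := by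
  have h := (((hasStrictFDerivAt_norm_sq y).hasFDerivAt).const_mul (-(1 / 4) : ℝ)).exp
  have h' : HasFDerivAt (gs d) _ y := h
  refine ⟨h'.differentiableAt, ?_⟩
  rw [h'.fderiv]
  simp [gs, EuclideanSpace.inner_single_right]
  ring

/-- the curve -/
def pth (d : ℕ) (z : Pt d) (σ : ℝ) (y : Ed d) : Pt d := (z.1 + σ ^ 2, z.2 + σ • y)

lemma pth_cont (d : ℕ) (z : Pt d) (σ : ℝ) : Continuous (pth d z σ) := by
  unfold pth; fun_prop

lemma int_gs_mul (d : ℕ) (W : Ed d → ℝ) (hW : Continuous W) (C : ℝ) (hC : ∀ y, ‖W y‖ ≤ C) :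
    Integrable (fun y => gs d y * W y) :=
  (gs_integrable d).mul_bdd hW.aestronglyMeasurable (Filter.Eventually.of_forall hC)

lemma coord_gs_integrable (d : ℕ) (j : Fin d) : Integrable (fun y : Ed d => y j * gs d y) := by
  refine Integrable.mono' (norm_gs_integrable d)
    (by have := gs_cont d; exact (by fun_prop : Continuous _).aestronglyMeasurable) ?_
  refine Filter.Eventually.of_forall fun y => ?_
  rw [norm_mul, Real.norm_of_nonneg (gs_pos d y).le]
  have := gs_pos d y
  gcongr
  exact PiLp.norm_apply_le y j

lemma int_coord_gs_mul (d : ℕ) (j : Fin d) (W : Ed d → ℝ) (hW : Continuous W) (C : ℝ)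
    (hC : ∀ y, ‖W y‖ ≤ C) : Integrable (fun y => y j * gs d y * W y) :=
  (coord_gs_integrable d j).mul_bdd hW.aestronglyMeasurable (Filter.Eventually.of_forall hC)

lemma spDeriv_cont (d : ℕ) (w : Pt d → ℝ) (hw : ContDiff ℝ 1 w) (a : Pt d) :
    Continuous (fun z => fderiv ℝ w z a) :=
  (hw.continuous_fderiv (by norm_num)).clm_apply continuous_const

lemma cs_dir (d : ℕ) (w : Pt d → ℝ) (hc : HasCompactSupport w) (a : Pt d) :
    HasCompactSupport (fun z => fderiv ℝ w z a) :=
  hc.fderiv_apply ℝ a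

lemma ibp (d : ℕ) (j : Fin d) (w : Pt d → ℝ) (hw : ContDiff ℝ 1 w) (hc : HasCompactSupport w)
    (z : Pt d) (σ : ℝ) :
    ∫ y, y j * gs d y * w (pth d z σ y) = 2 * σ * ∫ y, gs d y * spDeriv d j w (pth d z σ y) := by
  obtain ⟨C, hC⟩ := hw.continuous.bounded_above_of_compact_support hc
  obtain ⟨C', hC'⟩ := (spDeriv_cont d w hw (0, EuclideanSpace.single j 1)).bounded_above_of_compact_support
    (cs_dir d w hc _)
  have hp : ∀ y, HasFDerivAt (pth d z σ)
      ((0 : Ed d →L[ℝ] ℝ).prod (σ • ContinuousLinearMap.id ℝ (Ed d))) y := by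
    intro y
    refine HasFDerivAt.prodMk (hasFDerivAt_const _ _) ?_
    exact ((hasFDerivAt_id y).const_smul σ).const_add _
  have hW : ∀ y, HasFDerivAt (fun y => w (pth d z σ y)) ((fderiv ℝ w (pth d z σ y)).comp
      ((0 : Ed d →L[ℝ] ℝ).prod (σ • ContinuousLinearMap.id ℝ (Ed d)))) y := fun y =>
    ((hw.differentiable (by norm_num)) _).hasFDerivAt.comp y (hp y)
  have hWd : ∀ y, fderiv ℝ (fun y => w (pth d z σ y)) y (EuclideanSpace.single j 1) =
      σ * spDeriv d j w (pth d z σ y) := by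
    intro y
    rw [(hW y).fderiv]
    simp only [ContinuousLinearMap.comp_apply, ContinuousLinearMap.prod_apply, spDeriv]
    have : ((0 : Ed d →L[ℝ] ℝ) (EuclideanSpace.single j 1),
        (σ • ContinuousLinearMap.id ℝ (Ed d)) (EuclideanSpace.single j 1)) =
        σ • ((0 : ℝ), (EuclideanSpace.single j 1 : Ed d)) := by
      simp
    rw [this, map_smul, smul_eq_mul]
  have hpc := pth_cont d z σ
  have i1 := int_coord_gs_mul d j (fun y => w (pth d z σ y)) (hw.continuous.comp hpc) C
    (fun y => hC _)
  have i2 := int_gs_mul d (fun y => w (pth d z σ y)) (hw.continuous.comp hpc) C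
    (fun y => hC _)
  have i3 := int_gs_mul d (fun y => spDeriv d j w (pth d z σ y))
    ((spDeriv_cont d w hw (0, EuclideanSpace.single j 1)).comp hpc) C' (fun y => hC' _)
  have key := integral_mul_fderiv_eq_neg_fderiv_mul_of_integrable (μ := (volume : Measure (Ed d)))
    (f := gs d) (g := fun y => w (pth d z σ y)) (v := EuclideanSpace.single j 1)
    (by
      simp only [(gs_fderiv d j _).2]
      refine (i1.const_mul (-(1 / 2))).congr (Filter.Eventually.of_forall fun y => ?_)
      simp only; ring)
    (by
      simp only [hWd]
      refine (i3.const_mul σ).congr (Filter.Eventually.of_forall fun y => ?_)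
      simp only; ring)
    i2 (fun y _ => (gs_fderiv d j y).1) (fun y _ => (hW y).differentiableAt)
  simp only [hWd, (gs_fderiv d j _).2] at key
  have e1 : ∫ y, gs d y * (σ * spDeriv d j w (pth d z σ y)) =
      σ * ∫ y, gs d y * spDeriv d j w (pth d z σ y) := by
    rw [← integral_const_mul]; congr 1; funext y; ring
  have e2 : ∫ y, -(1 / 2) * (y j * gs d y) * w (pth d z σ y) =
      -(1 / 2) * ∫ y, y j * gs d y * w (pth d z σ y) := by
    rw [← integral_const_mul]; congr 1; funext y; ring
  rw [e1, e2] at key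
  linarith

lemma dir_smooth (d : ℕ) (u : Pt d → ℝ) (hu : ContDiff ℝ (⊤ : ℕ∞) u) (a : Pt d) :
    ContDiff ℝ (⊤ : ℕ∞) (fun z => fderiv ℝ u z a) :=
  (hu.fderiv_right (m := (⊤ : ℕ∞)) (by simp)).clm_apply contDiff_const

lemma dir_comm (d : ℕ) (u : Pt d → ℝ) (hu : ContDiff ℝ (⊤ : ℕ∞) u) (a b z : Pt d) :
    fderiv ℝ (fun z => fderiv ℝ u z a) z b = fderiv ℝ (fun z => fderiv ℝ u z b) z a := by
  have hd : DifferentiableAt ℝ (fderiv ℝ u) z :=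
    ((hu.fderiv_right (m := (⊤ : ℕ∞)) (by simp)).differentiable (by simp)) z
  have hs : IsSymmSndFDerivAt ℝ u z := hu.contDiffAt.isSymmSndFDerivAt (by
    simp only [minSmoothness_of_isRCLikeNormedField]; exact two_le_smooth)
  rw [fderiv_clm_apply hd (by fun_prop), fderiv_clm_apply hd (by fun_prop)]
  simp [hs a b]

/-- the heat operator -/
def heat (d : ℕ) (u : Pt d → ℝ) (z : Pt d) : ℝ := timeDeriv d u z + lap d u z

lemma heat_smooth (d : ℕ) (u : Pt d → ℝ) (hu : ContDiff ℝ (⊤ : ℕ∞) u) :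
    ContDiff ℝ (⊤ : ℕ∞) (heat d u) := by
  unfold heat lap
  refine (dir_smooth d u hu _).add (ContDiff.sum fun i _ => ?_)
  exact dir_smooth d _ (dir_smooth d u hu _) _

lemma heat_cs (d : ℕ) (u : Pt d → ℝ) (hc : HasCompactSupport u) : HasCompactSupport (heat d u) := by
  have h1 : tsupport (timeDeriv d u) ⊆ tsupport u := tsupport_fderiv_apply_subset ℝ _
  have h2 : ∀ i, tsupport (spDeriv d i (spDeriv d i u)) ⊆ tsupport u := fun i =>
    (tsupport_fderiv_apply_subset ℝ _).trans (tsupport_fderiv_apply_subset ℝ _)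
  refine HasCompactSupport.intro hc fun z hz => ?_
  have a1 : timeDeriv d u z = 0 := image_eq_zero_of_notMem_tsupport fun h => hz (h1 h)
  have a2 : ∀ i, spDeriv d i (spDeriv d i u) z = 0 := fun i =>
    image_eq_zero_of_notMem_tsupport fun h => hz (h2 i h)
  simp [heat, lap, a1, a2]

lemma heat_comm (d : ℕ) (u : Pt d → ℝ) (hu : ContDiff ℝ (⊤ : ℕ∞) u) (i : Fin d) (z : Pt d) :
    spDeriv d i (heat d u) z = heat d (spDeriv d i u) z := by
  have hsm : ∀ (v : Pt d → ℝ), ContDiff ℝ (⊤ : ℕ∞) v → ∀ z, DifferentiableAt ℝ v z := fun v hv z =>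
    hv.differentiable (by simp) z
  have e : heat d u = (fun z => timeDeriv d u z) +
      fun z => ∑ j : Fin d, spDeriv d j (spDeriv d j u) z := by
    funext z; simp [heat, lap]
  unfold heat lap
  rw [spDeriv]
  have hj : ∀ j, ContDiff ℝ (⊤ : ℕ∞) (spDeriv d j u) := fun j => dir_smooth d u hu _
  have hjj : ∀ j, ContDiff ℝ (⊤ : ℕ∞) (spDeriv d j (spDeriv d j u)) := fun j =>
    dir_smooth d _ (hj j) _
  have ht : ContDiff ℝ (⊤ : ℕ∞) (timeDeriv d u) := dir_smooth d u hu _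
  rw [fderiv_fun_add (hsm _ ht z) (hsm _ (ContDiff.sum fun j _ => hjj j) z),
    fderiv_fun_sum (fun j _ => hsm _ (hjj j) z)]
  simp only [_root_.add_apply, _root_.sum_apply]
  congr 1
  · exact dir_comm d u hu _ _ z
  · refine Finset.sum_congr rfl fun j _ => ?_
    have h1 : fderiv ℝ (spDeriv d j (spDeriv d j u)) z ((0 : ℝ), EuclideanSpace.single i 1) =
        spDeriv d j (spDeriv d i (spDeriv d j u)) z := dir_comm d _ (hj j) _ _ z
    have h2 : spDeriv d i (spDeriv d j u) = spDeriv d j (spDeriv d i u) := by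
      funext z; exact dir_comm d u hu _ _ z
    rw [h1, h2]

/-- the Gaussian mean of `v` along the curve -/
def Phi (d : ℕ) (v : Pt d → ℝ) (z : Pt d) (σ : ℝ) : ℝ := ∫ y, gs d y * v (pth d z σ y)

def dPhi (d : ℕ) (v : Pt d → ℝ) (z : Pt d) (σ : ℝ) : ℝ :=
  ∫ y, gs d y * fderiv ℝ v (pth d z σ y) (2 * σ, y)

lemma dPhi_bound (d : ℕ) (v : Pt d → ℝ) (z : Pt d) (C S : ℝ)
    (hC : ∀ w, ‖fderiv ℝ v w‖ ≤ C) (σ : ℝ) (hσ : |σ| ≤ S) (y : Ed d) :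
    ‖gs d y * fderiv ℝ v (pth d z σ y) (2 * σ, y)‖ ≤ C * (2 * S * gs d y + ‖y‖ * gs d y) := by
  have hg := gs_pos d y
  have hC0 : 0 ≤ C := (norm_nonneg _).trans (hC z)
  have hS0 : 0 ≤ S := (abs_nonneg _).trans hσ
  rw [norm_mul, Real.norm_of_nonneg hg.le]
  have h1 : ‖fderiv ℝ v (pth d z σ y) (2 * σ, y)‖ ≤ C * (2 * S + ‖y‖) := by
    refine (ContinuousLinearMap.le_opNorm _ _).trans ?_
    gcongr
    · exact hC _
    · rw [Prod.norm_def]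
      refine max_le ?_ ?_
      · simp only [norm_mul, Real.norm_eq_abs, Nat.abs_ofNat]
        have := norm_nonneg y
        linarith
      · simp only; linarith
  calc _ ≤ gs d y * (C * (2 * S + ‖y‖)) := by gcongr
    _ = _ := by ring

lemma dom_integrable (d : ℕ) (C S : ℝ) :
    Integrable (fun y : Ed d => C * (2 * S * gs d y + ‖y‖ * gs d y)) :=
  (((gs_integrable d).const_mul _).add (norm_gs_integrable d)).const_mul _

lemma integrand_cont (d : ℕ) (v : Pt d → ℝ) (hv : ContDiff ℝ 1 v) (z : Pt d) :
    Continuous (fun p : ℝ × Ed d => gs d p.2 * fderiv ℝ v (pth d z p.1 p.2) (2 * p.1, p.2)) := by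
  have h1 : Continuous (fun p : ℝ × Ed d => gs d p.2) := (gs_cont d).comp continuous_snd
  have h2 : Continuous (fun p : ℝ × Ed d => pth d z p.1 p.2) := by unfold pth; fun_prop
  have h3 := (hv.continuous_fderiv (by norm_num)).comp h2
  exact h1.mul (h3.clm_apply (by fun_prop))

lemma fderiv_bdd (d : ℕ) (v : Pt d → ℝ) (hv : ContDiff ℝ 1 v) (hc : HasCompactSupport v) :
    ∃ C, ∀ w, ‖fderiv ℝ v w‖ ≤ C :=
  (hv.continuous_fderiv (by norm_num)).bounded_above_of_compact_support (hc.fderiv ℝ)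

lemma Phi_deriv (d : ℕ) (v : Pt d → ℝ) (hv : ContDiff ℝ 1 v) (hc : HasCompactSupport v)
    (z : Pt d) (σ : ℝ) : HasDerivAt (Phi d v z) (dPhi d v z σ) σ := by
  obtain ⟨C, hC⟩ := fderiv_bdd d v hv hc
  obtain ⟨C0, hC0⟩ := hv.continuous.bounded_above_of_compact_support hc
  have hF : ∀ σ, Continuous (fun y => gs d y * v (pth d z σ y)) := fun σ =>
    (gs_cont d).mul (hv.continuous.comp (pth_cont d z σ))
  refine (hasDerivAt_integral_of_dominated_loc_of_deriv_le
    (F := fun σ y => gs d y * v (pth d z σ y))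
    (F' := fun σ y => gs d y * fderiv ℝ v (pth d z σ y) (2 * σ, y))
    (bound := fun y => C * (2 * (|σ| + 1) * gs d y + ‖y‖ * gs d y))
    (Metric.ball_mem_nhds σ one_pos)
    (Filter.Eventually.of_forall fun σ => (hF σ).aestronglyMeasurable)
    (int_gs_mul d _ (hv.continuous.comp (pth_cont d z σ)) C0 fun y => hC0 _)
    ?_ ?_ (dom_integrable d _ _) ?_).2
  · exact ((integrand_cont d v hv z).comp
      (by fun_prop : Continuous fun y : Ed d => (σ, y))).aestronglyMeasurable
  · refine Filter.Eventually.of_forall fun y s hs => ?_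
    refine dPhi_bound d v z C _ hC s ?_ y
    rw [Metric.mem_ball, Real.dist_eq] at hs
    have := abs_sub_abs_le_abs_sub s σ
    linarith
  · refine Filter.Eventually.of_forall fun y s _ => ?_
    refine HasDerivAt.const_mul _ ?_
    have hp : HasDerivAt (fun s => pth d z s y) (2 * s, y) s := by
      refine HasDerivAt.prodMk ?_ ?_
      · simpa using (hasDerivAt_pow 2 s).const_add z.1
      · simpa using ((hasDerivAt_id s).smul_const y).const_add z.2
    exact ((hv.differentiable (by norm_num)) _).hasFDerivAt.comp_hasDerivAt s hp

lemma dPhi_contOn (d : ℕ) (v : Pt d → ℝ) (hv : ContDiff ℝ 1 v) (hc : HasCompactSupport v)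
    (z : Pt d) (S : ℝ) : ContinuousOn (dPhi d v z) (Icc 0 S) := by
  obtain ⟨C, hC⟩ := fderiv_bdd d v hv hc
  have hcont := integrand_cont d v hv z
  unfold dPhi
  refine continuousOn_of_dominated (F := fun σ y => gs d y * fderiv ℝ v (pth d z σ y) (2 * σ, y))
    (bound := fun y => C * (2 * S * gs d y + ‖y‖ * gs d y)) ?_ ?_ (dom_integrable d _ _) ?_
  · exact fun σ _ => (hcont.comp
      (by fun_prop : Continuous fun y : Ed d => (σ, y))).aestronglyMeasurable
  · intro σ hσ
    refine Filter.Eventually.of_forall fun y => dPhi_bound d v z C S hC σ ?_ y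
    rw [abs_of_nonneg hσ.1]; exact hσ.2
  · refine Filter.Eventually.of_forall fun y => Continuous.continuousOn ?_
    have h : Continuous (fun σ : ℝ => (σ, y)) := Continuous.prodMk continuous_id continuous_const
    have h2 := hcont.comp h
    simp only [Function.comp_def] at h2
    exact h2

lemma dPhi_eq (d : ℕ) (u : Pt d → ℝ) (hu : ContDiff ℝ (⊤ : ℕ∞) u) (hc : HasCompactSupport u)
    (i : Fin d) (z : Pt d) (σ : ℝ) :
    dPhi d (spDeriv d i u) z σ = ∫ y, y i * gs d y * heat d u (pth d z σ y) := by
  have h1 : ∀ {w : Pt d → ℝ}, ContDiff ℝ (⊤ : ℕ∞) w → ContDiff ℝ 1 w := fun h =>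
    h.of_le (le_trans (by norm_num) two_le_smooth)
  have hv : ContDiff ℝ (⊤ : ℕ∞) (spDeriv d i u) := dir_smooth d u hu _
  have hvc : HasCompactSupport (spDeriv d i u) := cs_dir d u hc _
  set v := spDeriv d i u with hvdef
  rw [ibp d i (heat d u) (h1 (heat_smooth d u hu)) (heat_cs d u hc)]
  simp only [heat_comm d u hu, ← hvdef]
  have hpc := pth_cont d z σ
  have hvj : ∀ j, ContDiff ℝ (⊤ : ℕ∞) (spDeriv d j v) := fun j => dir_smooth d v hv _
  have hvjc : ∀ j, HasCompactSupport (spDeriv d j v) := fun j => cs_dir d v hvc _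
  have hvjj : ∀ j, ContDiff ℝ (⊤ : ℕ∞) (spDeriv d j (spDeriv d j v)) := fun j =>
    dir_smooth d _ (hvj j) _
  have hvjjc : ∀ j, HasCompactSupport (spDeriv d j (spDeriv d j v)) := fun j =>
    cs_dir d _ (hvjc j) _
  have hvt : ContDiff ℝ (⊤ : ℕ∞) (timeDeriv d v) := dir_smooth d v hv _
  have hvtc : HasCompactSupport (timeDeriv d v) := cs_dir d v hvc _
  have I1 : ∀ {w : Pt d → ℝ}, ContDiff ℝ (⊤ : ℕ∞) w → HasCompactSupport w →
      Integrable (fun y => gs d y * w (pth d z σ y)) := by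
    intro w hw hwc
    obtain ⟨C, hC⟩ := hw.continuous.bounded_above_of_compact_support hwc
    exact int_gs_mul d _ (hw.continuous.comp hpc) C fun y => hC _
  have I2 : ∀ {w : Pt d → ℝ} (j : Fin d), ContDiff ℝ (⊤ : ℕ∞) w → HasCompactSupport w →
      Integrable (fun y => y j * gs d y * w (pth d z σ y)) := by
    intro w j hw hwc
    obtain ⟨C, hC⟩ := hw.continuous.bounded_above_of_compact_support hwc
    exact int_coord_gs_mul d j _ (hw.continuous.comp hpc) C fun y => hC _
  have hdec : ∀ y : Ed d, ∀ p : Pt d, fderiv ℝ v p (2 * σ, y) =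
      2 * σ * timeDeriv d v p + ∑ j, y j * spDeriv d j v p := by
    intro y p
    have hy : ((2 * σ, y) : Pt d) = (2 * σ) • ((1 : ℝ), (0 : Ed d)) +
        ∑ j, y j • ((0 : ℝ), (EuclideanSpace.single j 1 : Ed d)) := by
      refine Prod.ext ?_ ?_
      · simp [Prod.fst_sum]
      · simp only [Prod.snd_add, Prod.smul_snd, Prod.snd_sum, smul_zero, zero_add]
        ext k
        simp [Pi.single_apply]
    rw [hy, map_add, map_smul, map_sum]
    simp only [map_smul, smul_eq_mul, timeDeriv, spDeriv]
  unfold dPhi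
  have e1 : ∀ y, gs d y * fderiv ℝ v (pth d z σ y) (2 * σ, y) =
      2 * σ * (gs d y * timeDeriv d v (pth d z σ y)) +
        ∑ j, y j * gs d y * spDeriv d j v (pth d z σ y) := by
    intro y
    rw [hdec, mul_add, Finset.mul_sum]
    congr 1
    · ring
    · exact Finset.sum_congr rfl fun j _ => by ring
  have e2 : ∀ y, gs d y * heat d v (pth d z σ y) = gs d y * timeDeriv d v (pth d z σ y) +
        ∑ j, gs d y * spDeriv d j (spDeriv d j v) (pth d z σ y) := by
    intro y
    rw [heat, lap, mul_add, Finset.mul_sum]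
  simp only [e1, e2]
  rw [integral_add ((I1 hvt hvtc).const_mul _) (integrable_finsetSum _ fun j _ =>
      I2 j (hvj j) (hvjc j)), integral_add (I1 hvt hvtc) (integrable_finsetSum _ fun j _ =>
      I1 (hvjj j) (hvjjc j)), integral_finsetSum _ (fun j _ => I2 j (hvj j) (hvjc j)),
      integral_finsetSum _ (fun j _ => I1 (hvjj j) (hvjjc j)), integral_const_mul, mul_add,
      Finset.mul_sum]
  congr 1
  exact Finset.sum_congr rfl fun j _ => ibp d j _ (h1 (hvj j)) (hvjc j) z σ

lemma repr_bound (d : ℕ) (u : Pt d → ℝ) (hu : ContDiff ℝ (⊤ : ℕ∞) u) (hc : HasCompactSupport u)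
    (i : Fin d) (z : Pt d) :
    ENNReal.ofReal ((∫ y, gs d y) * |spDeriv d i u z|) ≤
      ∫⁻ σ in Ioi (0 : ℝ), ∫⁻ y : Ed d, ENNReal.ofReal (‖y‖ * gs d y) *
        ENNReal.ofReal |heat d u (pth d z σ y)| := by
  have h1 : ∀ {w : Pt d → ℝ}, ContDiff ℝ (⊤ : ℕ∞) w → ContDiff ℝ 1 w := fun h =>
    h.of_le (le_trans (by norm_num) two_le_smooth)
  have hv : ContDiff ℝ (⊤ : ℕ∞) (spDeriv d i u) := dir_smooth d u hu _
  have hvc : HasCompactSupport (spDeriv d i u) := cs_dir d u hc _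
  set v := spDeriv d i u with hvdef
  obtain ⟨B, hB⟩ := hvc.isBounded.exists_norm_le
  have hvz : ∀ w : Pt d, B < ‖w‖ → v w = 0 := by
    intro w hw
    by_contra hne
    have := hB w (subset_tsupport _ hne)
    linarith
  set S := |z.1| + |B| + 1 with hS
  have hS1 : 1 ≤ S := by
    have := abs_nonneg z.1
    have := abs_nonneg B
    linarith
  have hPS : Phi d v z S = 0 := by
    unfold Phi
    rw [integral_eq_zero_of_ae]
    refine Filter.Eventually.of_forall fun y => ?_
    have : B < ‖pth d z S y‖ := by
      have h2 : ‖z.1 + S ^ 2‖ ≤ ‖pth d z S y‖ := norm_fst_le (pth d z S y)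
      have h3 : z.1 + S ^ 2 ≤ ‖z.1 + S ^ 2‖ := Real.le_norm_self _
      have h4 := neg_abs_le z.1
      have h5 := le_abs_self B
      nlinarith
    simp [hvz _ this]
  have hP0 : Phi d v z 0 = (∫ y, gs d y) * v z := by
    unfold Phi
    rw [← integral_mul_const]
    simp [pth]
  have hftc : ∫ σ in (0 : ℝ)..S, dPhi d v z σ = Phi d v z S - Phi d v z 0 := by
    refine intervalIntegral.integral_eq_sub_of_hasDerivAt
      (fun σ _ => Phi_deriv d v (h1 hv) hvc z σ) ?_
    refine ContinuousOn.intervalIntegrable ?_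
    rw [uIcc_of_le (by linarith)]
    exact dPhi_contOn d v (h1 hv) hvc z S
  rw [hPS, hP0, zero_sub] at hftc
  have hgp := gs_integral_pos d
  calc ENNReal.ofReal ((∫ y, gs d y) * |v z|) = ‖∫ σ in (0 : ℝ)..S, dPhi d v z σ‖ₑ := by
        rw [hftc, enorm_neg, ← ofReal_norm, norm_mul, Real.norm_of_nonneg hgp.le,
          Real.norm_eq_abs]
    _ ≤ ∫⁻ σ in Ioc 0 S, ‖dPhi d v z σ‖ₑ := by
        rw [intervalIntegral.integral_of_le (by linarith)]
        exact enorm_integral_le_lintegral_enorm _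
    _ ≤ ∫⁻ σ in Ioi 0, ‖dPhi d v z σ‖ₑ := lintegral_mono_set Ioc_subset_Ioi_self
    _ ≤ _ := by
        refine lintegral_mono fun σ => ?_
        rw [hvdef, dPhi_eq d u hu hc i z σ]
        refine (enorm_integral_le_lintegral_enorm _).trans (lintegral_mono fun y => ?_)
        have hg := gs_pos d y
        rw [← ofReal_norm, ← ENNReal.ofReal_mul (by positivity), norm_mul, norm_mul,
          Real.norm_of_nonneg hg.le, Real.norm_eq_abs (heat d u _)]
        apply ENNReal.ofReal_le_ofReal
        gcongr
        exact PiLp.norm_apply_le y i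

lemma morrey_bound (d : ℕ) (hd : 1 ≤ d) (q β : ℝ) (hq : 1 < q) (F : Pt d → ℝ)
    (hF0 : ∀ z, 0 ≤ F z)
    (hM : MorreyNorm d q β univ (fun z => ENNReal.ofReal (F z)) ≤ 1) (R : ℝ) (hR : 0 < R)
    (z : Pt d) : ∫⁻ w in pCyl d R z, ENNReal.ofReal (F w ^ q) ≤
      ENNReal.ofReal (Vd d * R ^ (d + 2) * R ^ (-(β * q))) := by
  have hV := Vd_pos d
  have hq0 : 0 < q := by linarith
  have h1 : ENNReal.ofReal (R ^ β) *
      (pAvg d R z fun w => (univ : Set (Pt d)).indicator (fun z => ENNReal.ofReal (F z)) w ^ q)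
        ^ (1 / q) ≤ 1 := by
    refine le_trans ?_ hM
    unfold MorreyNorm
    exact le_iSup₂_of_le R hR (le_iSup₂_of_le z (mem_univ z) le_rfl)
  have h2 := ENNReal.rpow_le_rpow h1 hq0.le
  rw [ENNReal.one_rpow, ENNReal.mul_rpow_of_nonneg _ _ hq0.le, ← ENNReal.rpow_mul,
    one_div_mul_cancel hq0.ne', ENNReal.rpow_one, ENNReal.ofReal_rpow_of_pos (by positivity),
    ← Real.rpow_mul hR.le, pAvg, vol_pCyl d hd R hR] at h2
  simp only [indicator_univ] at h2
  simp only [ENNReal.ofReal_rpow_of_nonneg (hF0 _) hq0.le] at h2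
  rw [← ENNReal.ofReal_inv_of_pos (by positivity), ← mul_assoc,
    ← ENNReal.ofReal_mul (by positivity)] at h2
  set c := R ^ (β * q) * (Vd d * R ^ (d + 2))⁻¹ with hc
  have hc0 : 0 < c := by positivity
  have e : Vd d * R ^ (d + 2) * R ^ (-(β * q)) = c⁻¹ := by
    rw [hc, Real.rpow_neg hR.le]; field_simp
  rw [e, ENNReal.ofReal_inv_of_pos hc0]
  rw [ENNReal.le_inv_iff_mul_le, mul_comm]
  exact h2

lemma morrey_bound1 (d : ℕ) (hd : 1 ≤ d) (q β : ℝ) (hq : 1 < q) (F : Pt d → ℝ)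
    (hF0 : ∀ z, 0 ≤ F z) (hFm : Measurable F) (R : ℝ) (hR : 0 < R) (z : Pt d)
    (h : ∫⁻ w in pCyl d R z, ENNReal.ofReal (F w ^ q) ≤
      ENNReal.ofReal (Vd d * R ^ (d + 2) * R ^ (-(β * q)))) :
    ∫⁻ w in pCyl d R z, ENNReal.ofReal (F w) ≤
      ENNReal.ofReal (Vd d * R ^ (d + 2) * R ^ (-β)) := by
  have hV := Vd_pos d
  have hq0 : 0 < q := by linarith
  have hc := Real.HolderConjugate.conjExponent hq
  set p := q.conjExponent
  have hp0 : 0 < p := hc.symm.pos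
  have H := ENNReal.lintegral_mul_le_Lp_mul_Lq (volume.restrict (pCyl d R z)) hc
    (f := fun w => ENNReal.ofReal (F w)) (g := fun _ => 1) hFm.ennreal_ofReal.aemeasurable
    aemeasurable_const
  simp only [Pi.mul_apply, mul_one, ENNReal.one_rpow, lintegral_const, one_mul,
    Measure.restrict_apply_univ, ENNReal.ofReal_rpow_of_nonneg (hF0 _) hq0.le,
    vol_pCyl d hd R hR] at H
  refine H.trans ?_
  set W := Vd d * R ^ (d + 2) with hW
  have hW0 : 0 < W := by positivity
  calc _ ≤ ENNReal.ofReal (W * R ^ (-(β * q))) ^ (1 / q) * ENNReal.ofReal W ^ (1 / p) := by gcongr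
    _ = _ := by
      rw [ENNReal.ofReal_rpow_of_pos (by positivity), ENNReal.ofReal_rpow_of_pos hW0,
        ← ENNReal.ofReal_mul (by positivity), Real.mul_rpow hW0.le (by positivity),
        ← Real.rpow_mul hR.le]
      congr 1
      have e1 : -(β * q) * (1 / q) = -β := by field_simp
      have e2 : W ^ (1 / q) * W ^ (1 / p) = W := by
        rw [← Real.rpow_add hW0, one_div, one_div, hc.inv_add_inv_eq_one, Real.rpow_one]
      rw [e1, mul_right_comm, e2]

lemma morrey_concl (d : ℕ) (hd : 1 ≤ d) (q β r A : ℝ) (hr : r * (β - 1) = q * β) (hr0 : 0 < r)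
    (hA : 0 < A) (G : Pt d → ℝ) (hG0 : ∀ z, 0 ≤ G z)
    (h : ∀ ρ, 0 < ρ → ∀ z0, ∫⁻ w in pCyl d ρ z0, ENNReal.ofReal (G w ^ r) ≤
      ENNReal.ofReal (A * (Vd d * ρ ^ (d + 2) * ρ ^ (-(β * q))))) :
    MorreyNorm d r (β - 1) univ (fun z => ENNReal.ofReal (G z)) ≤
      ENNReal.ofReal (A ^ (1 / r)) := by
  have hV := Vd_pos d
  unfold MorreyNorm
  refine iSup₂_le fun ρ hρ => iSup₂_le fun z _ => ?_
  simp only [indicator_univ, ENNReal.ofReal_rpow_of_nonneg (hG0 _) hr0.le]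
  rw [pAvg, vol_pCyl d hd ρ hρ, ← ENNReal.ofReal_inv_of_pos (by positivity)]
  calc _ ≤ ENNReal.ofReal (ρ ^ (β - 1)) * (ENNReal.ofReal (Vd d * ρ ^ (d + 2))⁻¹ *
        ENNReal.ofReal (A * (Vd d * ρ ^ (d + 2) * ρ ^ (-(β * q))))) ^ (1 / r) := by
        gcongr
        exact h ρ hρ z
    _ = _ := by
        rw [← ENNReal.ofReal_mul (by positivity)]
        have e1 : (Vd d * ρ ^ (d + 2))⁻¹ * (A * (Vd d * ρ ^ (d + 2) * ρ ^ (-(β * q)))) =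
            A * ρ ^ (-(β * q)) := by field_simp
        rw [e1, ENNReal.ofReal_rpow_of_pos (by positivity), ← ENNReal.ofReal_mul (by positivity),
          Real.mul_rpow hA.le (by positivity), ← Real.rpow_mul hρ.le]
        have e2 : -(β * q) * (1 / r) = -(β - 1) := by field_simp; linarith
        rw [e2, Real.rpow_neg hρ.le]
        congr 1
        field_simp

lemma morrey_scale (d : ℕ) (p β : ℝ) (hp : 0 < p) (c : ℝ) (hc : 0 ≤ c) (F : Pt d → ℝ) :
    MorreyNorm d p β univ (fun z => ENNReal.ofReal (c * F z)) =
      ENNReal.ofReal c * MorreyNorm d p β univ (fun z => ENNReal.ofReal (F z)) := by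
  unfold MorreyNorm
  simp only [ENNReal.mul_iSup, indicator_univ]
  refine iSup_congr fun ρ => iSup_congr fun hρ => iSup_congr fun z => iSup_congr fun _ => ?_
  simp only [ENNReal.ofReal_mul hc, ENNReal.mul_rpow_of_nonneg _ _ hp.le]
  rw [pAvg, pAvg, lintegral_const_mul' _ _
    (ENNReal.rpow_ne_top_of_nonneg hp.le ENNReal.ofReal_ne_top), mul_left_comm,
    ENNReal.mul_rpow_of_nonneg (ENNReal.ofReal c ^ p) _ (by positivity : 0 ≤ 1 / p),
    ← ENNReal.rpow_mul, mul_one_div_cancel hp.ne',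
    ENNReal.rpow_one]
  ring

lemma TT_scale (d : ℕ) (R c : ℝ) (hc : 0 ≤ c) (F : Pt d → ℝ) (z : Pt d) :
    TT d R (fun w => ENNReal.ofReal (c * F w)) z =
      ENNReal.ofReal c * TT d R (fun w => ENNReal.ofReal (F w)) z := by
  unfold TT
  simp only [ENNReal.ofReal_mul hc]
  rw [lintegral_const_mul' _ _ ENNReal.ofReal_ne_top]
  ring

lemma adams_morrey (d : ℕ) (hd : 1 ≤ d) (q β r : ℝ) (hq : 1 < q) (hβ : 1 < β)
    (hr : r * (β - 1) = q * β) (N0 : ℝ) (hN0 : 0 < N0) :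
    ∃ N : ℝ, 0 < N ∧ ∀ F G : Pt d → ℝ, Measurable F → Measurable G → (∀ z, 0 ≤ F z) →
    (∀ z, 0 ≤ G z) →
    (∀ δ, 0 < δ → ∀ z, ENNReal.ofReal (G z) ≤ ENNReal.ofReal N0 *
      (∑' k : ℕ, TT d (δ / 2 ^ (k + 1)) (fun w => ENNReal.ofReal (F w)) z +
        ∑' k : ℕ, TT d (δ * 2 ^ k) (fun w => ENNReal.ofReal (F w)) z)) →
    MorreyNorm d r (β - 1) univ (fun z => ENNReal.ofReal (G z)) ≤
      ENNReal.ofReal N * MorreyNorm d q β univ (fun z => ENNReal.ofReal (F z)) := by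
  obtain ⟨A, hA, H⟩ := adams d hd q β r hq hβ hr N0 hN0
  have hβ1 : 0 < β - 1 := by linarith
  have hq0 : 0 < q := by linarith
  have hr0 : 0 < r := by
    have : 0 < r * (β - 1) := by rw [hr]; positivity
    exact pos_of_mul_pos_left this hβ1.le
  have hNpos : 0 < A ^ (1 / r) := by positivity
  refine ⟨A ^ (1 / r), hNpos, ?_⟩
  intro F G hFm hGm hF0 hG0 hG
  set M := MorreyNorm d q β univ (fun z => ENNReal.ofReal (F z)) with hM
  -- the normalized claim
  have claim : ∀ κ : ℝ, 0 < κ → M ≤ ENNReal.ofReal κ →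
      MorreyNorm d r (β - 1) univ (fun z => ENNReal.ofReal (G z)) ≤
        ENNReal.ofReal (A ^ (1 / r)) * ENNReal.ofReal κ := by
    intro κ hκ hMκ
    have hκi : 0 < κ⁻¹ := by positivity
    have hM1 : MorreyNorm d q β univ (fun z => ENNReal.ofReal (κ⁻¹ * F z)) ≤ 1 := by
      rw [morrey_scale d q β hq0 _ hκi.le, ← hM]
      calc _ ≤ ENNReal.ofReal κ⁻¹ * ENNReal.ofReal κ := by gcongr
        _ = 1 := by rw [← ENNReal.ofReal_mul hκi.le, inv_mul_cancel₀ hκ.ne', ENNReal.ofReal_one]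
    have hF0' : ∀ z, 0 ≤ κ⁻¹ * F z := fun z => mul_nonneg hκi.le (hF0 z)
    have hG0' : ∀ z, 0 ≤ κ⁻¹ * G z := fun z => mul_nonneg hκi.le (hG0 z)
    have hq' := morrey_bound d hd q β hq (fun z => κ⁻¹ * F z) hF0' hM1
    have hfin := H (fun z => κ⁻¹ * F z) (fun z => κ⁻¹ * G z) (hFm.const_mul _) (hGm.const_mul _)
      hF0' hG0' (fun R hR z => morrey_bound1 d hd q β hq _ hF0' (hFm.const_mul _) R hR z
        (hq' R hR z)) hq' (by
          intro δ hδ z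
          simp only [TT_scale d _ _ hκi.le]
          rw [ENNReal.tsum_mul_left, ENNReal.tsum_mul_left, ← mul_add, mul_left_comm,
            ENNReal.ofReal_mul hκi.le]
          gcongr
          exact hG δ hδ z)
    have h3 := morrey_concl d hd q β r A hr hr0 hA _ hG0' hfin
    have h4 : MorreyNorm d r (β - 1) univ (fun z => ENNReal.ofReal (G z)) =
        ENNReal.ofReal κ * MorreyNorm d r (β - 1) univ (fun z => ENNReal.ofReal (κ⁻¹ * G z)) := by
      rw [← morrey_scale d r (β - 1) hr0 κ hκ.le]
      simp only [mul_inv_cancel_left₀ hκ.ne']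
    rw [h4, mul_comm]
    gcongr
  by_cases hMt : M = ⊤
  · rw [hMt, ENNReal.mul_top (by simpa using hNpos)]
    exact le_top
  have hlim : Filter.Tendsto (fun ε : ℝ => ENNReal.ofReal (A ^ (1 / r)) *
      ENNReal.ofReal (M.toReal + ε)) (nhdsWithin 0 (Ioi 0))
      (nhds (ENNReal.ofReal (A ^ (1 / r)) * M)) := by
    refine ENNReal.Tendsto.const_mul ?_ (Or.inr ENNReal.ofReal_ne_top)
    refine Filter.Tendsto.mono_left ?_ nhdsWithin_le_nhds
    have h0 : Filter.Tendsto (fun ε : ℝ => M.toReal + ε) (nhds 0) (nhds (M.toReal + 0)) :=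
      (continuous_const.add continuous_id).tendsto 0
    have h1 := ENNReal.tendsto_ofReal h0
    rwa [add_zero, ENNReal.ofReal_toReal hMt] at h1
  refine ge_of_tendsto hlim ?_
  filter_upwards [self_mem_nhdsWithin] with ε hε
  have hε : 0 < ε := hε
  refine claim _ (by positivity) ?_
  conv_lhs => rw [← ENNReal.ofReal_toReal hMt]
  exact ENNReal.ofReal_le_ofReal (by linarith)

lemma space_cov (d : ℕ) (σ : ℝ) (hσ : 0 < σ) (R : ℝ) (x : Ed d) (f : Ed d → ℝ≥0∞)
    (hf : Measurable f) :
    ∫⁻ y : Ed d, (if σ * ‖y‖ < R then f (x + σ • y) else 0) =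
      ENNReal.ofReal ((σ ^ d)⁻¹) * ∫⁻ w in Metric.ball x R, f w := by
  set h : Ed d → ℝ≥0∞ := (Metric.ball x R).indicator f with hh
  have hhm : Measurable h := hf.indicator measurableSet_ball
  have e1 : ∀ y : Ed d, (if σ * ‖y‖ < R then f (x + σ • y) else 0) = h (x + σ • y) := by
    intro y
    have h0 : (x + σ • y ∈ Metric.ball x R) ↔ σ * ‖y‖ < R := by
      rw [Metric.mem_ball, dist_eq_norm, add_sub_cancel_left, norm_smul, Real.norm_of_nonneg hσ.le]
    by_cases h2 : σ * ‖y‖ < R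
    · rw [if_pos h2, hh, indicator_of_mem (h0.2 h2)]
    · rw [if_neg h2, hh, indicator_of_notMem (fun h3 => h2 (h0.1 h3))]
  simp only [e1]
  have hm2 : Measurable (fun w : Ed d => h (x + w)) := hhm.comp (measurable_const_add x)
  have e2 : ∫⁻ y : Ed d, h (x + σ • y) =
      ∫⁻ w, h (x + w) ∂(Measure.map (fun y : Ed d => σ • y) volume) := by
    rw [lintegral_map hm2 (measurable_const_smul σ)]
  have e3 := Measure.map_addHaar_smul (volume : Measure (Ed d)) hσ.ne'
  rw [e2, e3, lintegral_smul_measure, lintegral_add_left_eq_self, hh,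
    lintegral_indicator measurableSet_ball, finrank_euclideanSpace_fin, abs_of_pos (by positivity),
    smul_eq_mul]

lemma time_cov (R t : ℝ) (hR : 0 < R) (H : ℝ → ℝ≥0∞) :
    ∫⁻ σ in Ioo 0 R, ENNReal.ofReal σ * H (t + σ ^ 2) ≤ ∫⁻ s in Ico t (t + R ^ 2), H s := by
  have hinj : InjOn (fun σ : ℝ => t + σ ^ 2) (Ioo 0 R) := by
    intro a ha b hb hab
    have h1 : a ^ 2 = b ^ 2 := add_left_cancel hab
    exact (pow_left_inj₀ ha.1.le hb.1.le two_ne_zero).1 h1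
  have hder : ∀ σ ∈ Ioo 0 R, HasDerivWithinAt (fun σ : ℝ => t + σ ^ 2) (2 * σ) (Ioo 0 R) σ := by
    intro σ _
    have := ((hasDerivAt_pow 2 σ).const_add t).hasDerivWithinAt (s := Ioo 0 R)
    simpa using this
  calc ∫⁻ σ in Ioo 0 R, ENNReal.ofReal σ * H (t + σ ^ 2)
      ≤ ∫⁻ σ in Ioo 0 R, ENNReal.ofReal |2 * σ| * H (t + σ ^ 2) := by
        refine setLIntegral_mono' measurableSet_Ioo fun σ hσ => ?_
        gcongr
        have := hσ.1
        rw [abs_of_pos (by linarith)]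
        linarith
    _ = ∫⁻ s in (fun σ : ℝ => t + σ ^ 2) '' Ioo 0 R, H s :=
        (lintegral_image_eq_lintegral_abs_deriv_mul measurableSet_Ioo hder hinj H).symm
    _ ≤ _ := by
        refine lintegral_mono_set ?_
        rintro _ ⟨σ, hσ, rfl⟩
        have h1 := hσ.1
        have h2 := hσ.2
        refine ⟨by simp only; nlinarith, ?_⟩
        simp only
        nlinarith

/-- discretized kernel -/
def KK (d : ℕ) (c R σ : ℝ) (y : Ed d) : ℝ≥0∞ :=
  if σ < R ∧ σ * ‖y‖ < R then ENNReal.ofReal (c * σ ^ (d + 1) / R ^ (d + 1)) else 0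

lemma KK_meas (d : ℕ) (c R : ℝ) : Measurable (fun p : ℝ × Ed d => KK d c R p.1 p.2) := by
  unfold KK
  refine Measurable.ite ?_ (by fun_prop) measurable_const
  exact (measurableSet_lt measurable_fst measurable_const).inter
    (measurableSet_lt (measurable_fst.mul measurable_snd.norm) measurable_const)

lemma per_R (d : ℕ) (c R : ℝ) (hc : 0 < c) (hR : 0 < R) (z : Pt d) (Fe : Pt d → ℝ≥0∞)
    (hF : Measurable Fe) :
    ∫⁻ σ in Ioi (0 : ℝ), ∫⁻ y : Ed d, KK d c R σ y * Fe (pth d z σ y) ≤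
      ENNReal.ofReal c * TT d R Fe z := by
  set H : ℝ → ℝ≥0∞ := fun s => ∫⁻ w in Metric.ball z.2 R, Fe (s, w) with hH
  have h1 : ∀ σ ∈ Ioi (0 : ℝ), ∫⁻ y : Ed d, KK d c R σ y * Fe (pth d z σ y) ≤
      (Ioo 0 R).indicator (fun σ => ENNReal.ofReal (c / R ^ (d + 1)) *
        (ENNReal.ofReal σ * H (z.1 + σ ^ 2))) σ := by
    intro σ hσ
    have hσ' : 0 < σ := hσ
    by_cases hl : σ < R
    · rw [indicator_of_mem (show σ ∈ Ioo 0 R from ⟨hσ, hl⟩)]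
      have e : ∀ y : Ed d, KK d c R σ y * Fe (pth d z σ y) =
          ENNReal.ofReal (c * σ ^ (d + 1) / R ^ (d + 1)) *
          (if σ * ‖y‖ < R then (fun w => Fe (z.1 + σ ^ 2, w)) (z.2 + σ • y) else 0) := by
        intro y
        unfold KK pth
        by_cases h : σ * ‖y‖ < R <;> simp [h, hl]
      simp only [e]
      rw [lintegral_const_mul' _ _ ENNReal.ofReal_ne_top,
        space_cov d σ hσ' R z.2 (fun w => Fe (z.1 + σ ^ 2, w)) (by fun_prop), ← mul_assoc,
        ← ENNReal.ofReal_mul (by positivity), ← mul_assoc, ← ENNReal.ofReal_mul (by positivity)]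
      apply le_of_eq
      congr 2
      field_simp
      ring
    · have e : ∀ y : Ed d, KK d c R σ y * Fe (pth d z σ y) = 0 := by
        intro y; simp [KK, hl]
      simp [e]
  calc _ ≤ ∫⁻ σ in Ioi (0 : ℝ), (Ioo 0 R).indicator (fun σ => ENNReal.ofReal (c / R ^ (d + 1)) *
        (ENNReal.ofReal σ * H (z.1 + σ ^ 2))) σ := setLIntegral_mono' measurableSet_Ioi h1
    _ ≤ ∫⁻ σ, (Ioo 0 R).indicator (fun σ => ENNReal.ofReal (c / R ^ (d + 1)) *
        (ENNReal.ofReal σ * H (z.1 + σ ^ 2))) σ := setLIntegral_le_lintegral _ _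
    _ = ENNReal.ofReal (c / R ^ (d + 1)) *
          ∫⁻ σ in Ioo 0 R, ENNReal.ofReal σ * H (z.1 + σ ^ 2) := by
        rw [lintegral_indicator measurableSet_Ioo, lintegral_const_mul' _ _ ENNReal.ofReal_ne_top]
    _ ≤ ENNReal.ofReal (c / R ^ (d + 1)) * ∫⁻ s in Ico z.1 (z.1 + R ^ 2), H s := by
        exact mul_le_mul_right (time_cov R z.1 hR H) _
    _ = _ := by
        unfold TT
        rw [pCyl_eq, Measure.volume_eq_prod, setLIntegral_prod _ hF.aemeasurable, ← mul_assoc,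
          ← ENNReal.ofReal_mul hc.le, div_eq_mul_inv]

lemma ker_le (d : ℕ) (A : ℝ)
    (hdec : ∀ y : Ed d, (max 1 ‖y‖) ^ (d + 1) * (‖y‖ * gs d y) ≤ A) (δ : ℝ) (hδ : 0 < δ)
    (σ : ℝ) (hσ : 0 < σ) (y : Ed d) :
    ENNReal.ofReal (‖y‖ * gs d y) ≤
      ∑' k : ℕ, KK d (A * 2 ^ (d + 1)) (δ / 2 ^ (k + 1)) σ y +
        ∑' k : ℕ, KK d (A * 2 ^ (d + 1)) (δ * 2 ^ k) σ y := by
  set M := max 1 ‖y‖ with hM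
  have hM1 : 1 ≤ M := le_max_left _ _
  have hMy : ‖y‖ ≤ M := le_max_right _ _
  have hM0 : 0 < M := by linarith
  have key : ∀ R, 0 < R → R / 2 ≤ σ * M → σ * M < R →
      ENNReal.ofReal (‖y‖ * gs d y) ≤ KK d (A * 2 ^ (d + 1)) R σ y := by
    intro R hR h1 h2
    unfold KK
    rw [if_pos ⟨by nlinarith, by nlinarith⟩]
    apply ENNReal.ofReal_le_ofReal
    have h3 := hdec y
    rw [le_div_iff₀ (by positivity)]
    have h4 : R ^ (d + 1) ≤ (2 * (σ * M)) ^ (d + 1) := by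
      gcongr
      linarith
    have h5 : 0 ≤ ‖y‖ * gs d y := mul_nonneg (norm_nonneg _) (gs_pos d y).le
    calc ‖y‖ * gs d y * R ^ (d + 1) ≤ ‖y‖ * gs d y * (2 * (σ * M)) ^ (d + 1) := by gcongr
      _ = (M ^ (d + 1) * (‖y‖ * gs d y)) * (2 ^ (d + 1) * σ ^ (d + 1)) := by
        rw [mul_pow, mul_pow]; ring
      _ ≤ A * (2 ^ (d + 1) * σ ^ (d + 1)) := by gcongr
      _ = _ := by ring
  obtain ⟨n, hn1, hn2⟩ := exists_mem_Ico_zpow (x := σ * M / δ) (y := 2) (by positivity)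
    (by norm_num)
  have h1 : δ * (2:ℝ) ^ n ≤ σ * M := by
    rw [le_div_iff₀ hδ] at hn1; linarith
  have h2 : σ * M < δ * (2:ℝ) ^ (n + 1) := by
    rw [div_lt_iff₀ hδ] at hn2; linarith
  have h3 : δ * (2:ℝ) ^ (n + 1) / 2 = δ * (2:ℝ) ^ n := by
    rw [zpow_add_one₀ (by norm_num)]; ring
  rcases hk : n + 1 with k | k
  · rw [hk] at h2 h3
    have e : (2:ℝ) ^ (Int.ofNat k) = 2 ^ k := by simp
    rw [e] at h2 h3
    refine (key (δ * 2 ^ k) (by positivity) (by rw [h3]; exact h1) h2).trans ?_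
    refine le_trans ?_ le_add_self
    exact ENNReal.le_tsum (f := fun k : ℕ => KK d (A * 2 ^ (d + 1)) (δ * 2 ^ k) σ y) k
  · rw [hk] at h2 h3
    have e : δ * (2:ℝ) ^ (Int.negSucc k) = δ / 2 ^ (k + 1) := by
      rw [zpow_negSucc, div_eq_mul_inv]
    rw [e] at h2 h3
    refine (key (δ / 2 ^ (k + 1)) (by positivity) (by rw [h3]; exact h1) h2).trans ?_
    refine le_trans ?_ le_self_add
    exact ENNReal.le_tsum (f := fun k : ℕ => KK d (A * 2 ^ (d + 1)) (δ / 2 ^ (k + 1)) σ y) k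

lemma tsum_R (d : ℕ) (c : ℝ) (hc : 0 < c) (R : ℕ → ℝ) (hR : ∀ k, 0 < R k) (z : Pt d)
    (Fe : Pt d → ℝ≥0∞) (hF : Measurable Fe) :
    ∫⁻ σ in Ioi (0 : ℝ), ∫⁻ y : Ed d, (∑' k, KK d c (R k) σ y) * Fe (pth d z σ y) ≤
      ENNReal.ofReal c * ∑' k, TT d (R k) Fe z := by
  have hpm : Measurable (fun p : ℝ × Ed d => Fe (pth d z p.1 p.2)) := by
    refine hF.comp ?_
    unfold pth
    fun_prop
  have hm : ∀ k, Measurable (fun p : ℝ × Ed d => KK d c (R k) p.1 p.2 * Fe (pth d z p.1 p.2)) :=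
    fun k => (KK_meas d c (R k)).mul hpm
  have e1 : ∀ σ, ∫⁻ y : Ed d, (∑' k, KK d c (R k) σ y) * Fe (pth d z σ y) =
      ∑' k, ∫⁻ y : Ed d, KK d c (R k) σ y * Fe (pth d z σ y) := by
    intro σ
    simp only [← ENNReal.tsum_mul_right]
    exact lintegral_tsum fun k => ((hm k).comp measurable_prodMk_left).aemeasurable
  simp only [e1]
  rw [lintegral_tsum fun k => (Measurable.lintegral_prod_right (hm k)).aemeasurable,
    ← ENNReal.tsum_mul_left]
  exact ENNReal.tsum_le_tsum fun k => per_R d c (R k) hc (hR k) z Fe hF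

lemma discretize (d : ℕ) (A : ℝ) (hA : 0 < A)
    (hdec : ∀ y : Ed d, (max 1 ‖y‖) ^ (d + 1) * (‖y‖ * gs d y) ≤ A) (δ : ℝ) (hδ : 0 < δ)
    (z : Pt d) (Fe : Pt d → ℝ≥0∞) (hF : Measurable Fe) :
    ∫⁻ σ in Ioi (0 : ℝ), ∫⁻ y : Ed d, ENNReal.ofReal (‖y‖ * gs d y) * Fe (pth d z σ y) ≤
      ENNReal.ofReal (A * 2 ^ (d + 1)) *
        (∑' k : ℕ, TT d (δ / 2 ^ (k + 1)) Fe z + ∑' k : ℕ, TT d (δ * 2 ^ k) Fe z) := by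
  have hc : 0 < A * 2 ^ (d + 1) := by positivity
  have hpm : Measurable (fun p : ℝ × Ed d => Fe (pth d z p.1 p.2)) := by
    refine hF.comp ?_
    unfold pth
    fun_prop
  have hm : Measurable (fun p : ℝ × Ed d =>
      (∑' k : ℕ, KK d (A * 2 ^ (d + 1)) (δ / 2 ^ (k + 1)) p.1 p.2) * Fe (pth d z p.1 p.2)) :=
    (Measurable.tsum fun k => KK_meas d _ _).mul hpm
  calc _ ≤ ∫⁻ σ in Ioi (0 : ℝ),
        ((∫⁻ y : Ed d, (∑' k : ℕ, KK d (A * 2 ^ (d + 1)) (δ / 2 ^ (k + 1)) σ y) *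
          Fe (pth d z σ y)) +
        ∫⁻ y : Ed d, (∑' k : ℕ, KK d (A * 2 ^ (d + 1)) (δ * 2 ^ k) σ y) * Fe (pth d z σ y)) := by
        refine setLIntegral_mono' measurableSet_Ioi fun σ hσ => ?_
        have hm1 : Measurable (fun y : Ed d =>
          (∑' k : ℕ, KK d (A * 2 ^ (d + 1)) (δ / 2 ^ (k + 1)) σ y) * Fe (pth d z σ y)) :=
          hm.comp measurable_prodMk_left
        rw [← lintegral_add_left hm1]
        refine lintegral_mono fun y => ?_
        rw [← add_mul]
        gcongr
        exact ker_le d A hdec δ hδ σ hσ y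
    _ ≤ _ := by
        rw [lintegral_add_left (Measurable.lintegral_prod_right hm), mul_add]
        exact add_le_add (tsum_R d _ hc _ (fun k => by positivity) z Fe hF)
          (tsum_R d _ hc _ (fun k => by positivity) z Fe hF)

lemma grad_bound (d : ℕ) (hd : 1 ≤ d) : ∃ N0 : ℝ, 0 < N0 ∧ ∀ u : Pt d → ℝ,
    ContDiff ℝ (⊤ : ℕ∞) u → HasCompactSupport u → ∀ δ, 0 < δ → ∀ z,
    ENNReal.ofReal (gradNorm d u z) ≤ ENNReal.ofReal N0 *
      (∑' k : ℕ, TT d (δ / 2 ^ (k + 1)) (fun w => ENNReal.ofReal |heat d u w|) z +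
        ∑' k : ℕ, TT d (δ * 2 ^ k) (fun w => ENNReal.ofReal |heat d u w|) z) := by
  obtain ⟨A, hA, hdec⟩ := gs_decay d
  have hI := gs_integral_pos d
  set I := ∫ y, gs d y with hIdef
  have hd0 : (0:ℝ) < d := by exact_mod_cast hd
  refine ⟨d * (I⁻¹ * (A * 2 ^ (d + 1))), by positivity, fun u hu hc δ hδ z => ?_⟩
  have hF : Measurable (fun w => ENNReal.ofReal |heat d u w|) :=
    ((heat_smooth d u hu).continuous.abs.measurable).ennreal_ofReal
  set T := ∑' k : ℕ, TT d (δ / 2 ^ (k + 1)) (fun w => ENNReal.ofReal |heat d u w|) z +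
        ∑' k : ℕ, TT d (δ * 2 ^ k) (fun w => ENNReal.ofReal |heat d u w|) z with hT
  have h1 : ∀ i, ENNReal.ofReal |spDeriv d i u z| ≤
      ENNReal.ofReal (I⁻¹ * (A * 2 ^ (d + 1))) * T := by
    intro i
    have h2 := (repr_bound d u hu hc i z).trans (discretize d A hA hdec δ hδ z _ hF)
    rw [← hT, ← hIdef] at h2
    calc ENNReal.ofReal |spDeriv d i u z| =
          ENNReal.ofReal I⁻¹ * ENNReal.ofReal (I * |spDeriv d i u z|) := by
          rw [← ENNReal.ofReal_mul (by positivity), inv_mul_cancel_left₀ hI.ne']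
      _ ≤ ENNReal.ofReal I⁻¹ * (ENNReal.ofReal (A * 2 ^ (d + 1)) * T) := by gcongr
      _ = _ := by rw [← mul_assoc, ← ENNReal.ofReal_mul (by positivity)]
  have h3 : gradNorm d u z ≤ ∑ i, |spDeriv d i u z| := by
    unfold gradNorm
    rw [Real.sqrt_le_left (Finset.sum_nonneg fun i _ => abs_nonneg _)]
    calc ∑ i, spDeriv d i u z ^ 2 = ∑ i, |spDeriv d i u z| ^ 2 := by simp only [sq_abs]
      _ ≤ _ := Finset.sum_sq_le_sq_sum_of_nonneg (fun i _ => abs_nonneg _)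
  calc ENNReal.ofReal (gradNorm d u z) ≤ ENNReal.ofReal (∑ i, |spDeriv d i u z|) :=
        ENNReal.ofReal_le_ofReal h3
    _ = ∑ i, ENNReal.ofReal |spDeriv d i u z| :=
        ENNReal.ofReal_sum_of_nonneg fun i _ => abs_nonneg _
    _ ≤ ∑ _i : Fin d, ENNReal.ofReal (I⁻¹ * (A * 2 ^ (d + 1))) * T :=
        Finset.sum_le_sum fun i _ => h1 i
    _ = _ := by
        rw [Finset.sum_const, Finset.card_univ, Fintype.card_fin, nsmul_eq_mul, ← mul_assoc,
          ENNReal.ofReal_mul hd0.le, ENNReal.ofReal_natCast]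

/-- Corollary 3.4: if `1 < q < d+2`, `β ∈ (1,(d+2)/q]` and `r(β−1) = qβ`,
then `‖Du‖_{E_{r,β−1}} ≤ N ‖∂_t u + Δu‖_{E_{q,β}}` for `u ∈ C_0^∞`. -/
theorem stmt7 (d : ℕ) (hd : 1 ≤ d) (q β r : ℝ) (hq : 1 < q) (hq' : q < (d : ℝ) + 2)
    (hβ : 1 < β) (hβ' : β ≤ ((d : ℝ) + 2) / q) (hr : r * (β - 1) = q * β) :
    ∃ N : ℝ, 0 < N ∧ ∀ u : Pt d → ℝ, ContDiff ℝ (⊤ : ℕ∞) u → HasCompactSupport u →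
      MorreyNorm d r (β - 1) univ (fun z => ENNReal.ofReal (gradNorm d u z)) ≤
        ENNReal.ofReal N *
          MorreyNorm d q β univ (fun z => ENNReal.ofReal |timeDeriv d u z + lap d u z|) := by
  obtain ⟨N0, hN0, hb⟩ := grad_bound d hd
  obtain ⟨N, hN, H⟩ := adams_morrey d hd q β r hq hβ hr N0 hN0
  refine ⟨N, hN, fun u hu hc => ?_⟩
  have hG : Measurable (gradNorm d u) := by
    unfold gradNorm
    refine Continuous.measurable ?_
    refine Real.continuous_sqrt.comp (continuous_finset_sum _ fun i _ => ?_)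
    have hs : ContDiff ℝ (⊤ : ℕ∞) (spDeriv d i u) := dir_smooth d u hu _
    exact hs.continuous.pow 2
  exact H (fun z => |heat d u z|) (gradNorm d u) (heat_smooth d u hu).continuous.abs.measurable hG
    (fun z => abs_nonneg _) (fun z => Real.sqrt_nonneg _) (fun δ hδ z => hb u hu hc δ hδ z)
end
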